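/- arXiv:1510.06207 — 8 statements merged into one kernel-verified Lean document; each statement's English description precedes it below -/
import Mathlib

section
/- Functional delta-method, part (i) (Theorem D.4(i)): Let (E,‖·‖_E) be a normed real vector space with open-ball σ-algebra ℬ°, and (Ẽ,‖·‖_Ẽ) a normed real vector space with open-ball σ-algebra ℬ̃°. Let E₀ ⊆ E be a ‖·‖_E-separable subset with E₀ ∈ ℬ°, let V_H ⊆ E, x ∈ V_H, and (a_n) a sequence of positive reals with a_n → ∞. For each n ≥ 1 let X_n : Ω_n → E be a map on a probability space (Ω_n,ℱ_n,ℙ_n). Assume: (a) X_n takes values only in V_H; (b) a_n(X_n − x) is (ℱ_n,ℬ°)-measurable and converges in distribution° to an (E,ℬ°)-valued random variable X₀ on a probability space (Ω₀,ℱ₀,ℙ₀) with X₀(Ω₀) ⊆ E₀; (c) a_n(H(X_n) − H(x)) is (ℱ_n,ℬ̃°)-measurable for every n; (d) H : V_H → Ẽ is quasi-Hadamard differentiable at x tangentially to E₀⟨E⟩ with quasi-Hadamard derivative Ḣ_x : E₀ → Ẽ. Then Ḣ_x(X₀) is (ℱ₀,ℬ̃°)-measurable and a_n(H(X_n) − H(x))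 converges in distribution° to Ḣ_x(X₀) in (Ẽ,ℬ̃°,‖·‖_Ẽ). -/
open MeasureTheory Filter Topology

/-- The open-ball σ-algebra on a (pseudo)metric space: the σ-algebra generated by the
open balls `B_r(x) = {y | dist x y < r}`, `x ∈ E`, `r > 0`. -/
def ballSigma (E : Type*) [PseudoMetricSpace E] : MeasurableSpace E :=
  MeasurableSpace.generateFrom {s : Set E | ∃ (x : E) (r : ℝ), 0 < r ∧ s = Metric.ball x r}

/-- Quasi-Hadamard differentiability of `H : V_H → F` at `x` tangentially to `E₀⟨E⟩`
(here the ambient vector space `V` equals `E`), with quasi-Hadamard derivative `H'`.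
The derivative is a continuous map defined on `E₀`; it is modelled as a total map
`H' : E → F` whose values on `E₀` are the relevant ones. -/
def QuasiHadamardAt {E F : Type*} [NormedAddCommGroup E] [NormedSpace ℝ E]
    [NormedAddCommGroup F] [NormedSpace ℝ F]
    (VH : Set E) (H : E → F) (x : E) (E₀ : Set E) (H' : E → F) : Prop :=
  ContinuousOn H' E₀ ∧
  ∀ x₀ ∈ E₀, ∀ xs : ℕ → E, ∀ εs : ℕ → ℝ,
    (∀ n, 0 < εs n) → Tendsto εs atTop (𝓝 0) →
    Tendsto (fun n => ‖xs n - x₀‖) atTop (𝓝 0) →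
    (∀ n, x + εs n • xs n ∈ VH) →
    Tendsto (fun n => ‖H' x₀ - (εs n)⁻¹ • (H (x + εs n • xs n) - H x)‖) atTop (𝓝 0)

lemma integrable_of_forall_abs_le {Ω : Type*} [MeasurableSpace Ω] (Q : Measure Ω)
    [IsFiniteMeasure Q] {f : Ω → ℝ} {C : ℝ} (hf : Measurable f) (hfC : ∀ ω, |f ω| ≤ C) :
    Integrable f Q :=
  .of_bound hf.aestronglyMeasurable C (.of_forall hfC)

section BallSigma

variable {E : Type*} [PseudoMetricSpace E]

/-- A separable subset contains a sequence which is dense in it. -/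
lemma exists_seq_dist_lt_of_isSeparable {E₀ : Set E} (hsep : TopologicalSpace.IsSeparable E₀)
    (hne : E₀.Nonempty) : ∃ e : ℕ → E, ∀ y ∈ E₀, ∀ r > 0, ∃ i, dist y (e i) < r := by
  have := hsep.separableSpace
  have := hne.to_subtype
  refine ⟨fun i => TopologicalSpace.denseSeq E₀ i, fun y hy r hr => ?_⟩
  exact (TopologicalSpace.denseRange_denseSeq E₀).exists_dist_lt ⟨y, hy⟩ hr

variable [MeasurableSpace E]

lemma measurable_dist_of_eq_ballSigma (hmE : ‹MeasurableSpace E› = ballSigma E) (e : E) :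
    Measurable fun y : E => dist y e := by
  refine measurable_of_Iio fun r => ?_
  change MeasurableSet (Metric.ball e r)
  rcases le_or_gt r 0 with hr | hr
  · rw [Metric.ball_eq_empty.2 hr]
    exact MeasurableSet.empty
  · rw [hmE]
    exact MeasurableSpace.measurableSet_generateFrom ⟨e, r, hr, rfl⟩

/-- A ball-measurable map with values in a separable set is Borel measurable. -/
lemma measurableSet_preimage_of_isOpen (hmE : ‹MeasurableSpace E› = ballSigma E)
    {E₀ : Set E} (hsep : TopologicalSpace.IsSeparable E₀)
    {Ω : Type*} [MeasurableSpace Ω] {f : Ω → E} (hf : Measurable f) (hfE₀ : ∀ ω, f ω ∈ E₀)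
    {V : Set E} (hV : IsOpen V) : MeasurableSet (f ⁻¹' V) := by
  rcases E₀.eq_empty_or_nonempty with h | hne
  · have : IsEmpty Ω := ⟨fun ω => by simpa [h] using hfE₀ ω⟩
    rw [Set.eq_empty_of_isEmpty (f ⁻¹' V)]
    exact MeasurableSet.empty
  obtain ⟨e, he⟩ := exists_seq_dist_lt_of_isSeparable hsep hne
  have hUnion : f ⁻¹' V = ⋃ (i : ℕ) (n : ℕ) (_ : Metric.ball (e i) (1 / (n + 1 : ℝ)) ⊆ V),
      {ω | dist (f ω) (e i) < 1 / (n + 1 : ℝ)} := by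
    ext ω
    simp only [Set.mem_preimage, Set.mem_iUnion, Set.mem_ofPred_eq, exists_prop]
    constructor
    · intro hω
      obtain ⟨r, hr, hball⟩ := Metric.isOpen_iff.1 hV _ hω
      obtain ⟨n, hn⟩ := exists_nat_one_div_lt (half_pos hr)
      obtain ⟨i, hi⟩ := he _ (hfE₀ ω) (1 / (n + 1 : ℝ)) (by positivity)
      refine ⟨i, n, fun z hz => hball ?_, hi⟩
      rw [Metric.mem_ball] at hz ⊢
      linarith [dist_triangle_right z (f ω) (e i)]
    · rintro ⟨i, n, hball, hi⟩
      exact hball hi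
  rw [hUnion]
  exact .iUnion fun i => .iUnion fun n => .iUnion fun _ =>
    measurableSet_lt ((measurable_dist_of_eq_ballSigma hmE (e i)).comp hf) measurable_const

lemma measurable_comp_of_continuousOn_of_isSeparable (hmE : ‹MeasurableSpace E› = ballSigma E)
    {F : Type*} [PseudoMetricSpace F] [MeasurableSpace F]
    (hmF : ‹MeasurableSpace F› = ballSigma F)
    {E₀ : Set E} (hsep : TopologicalSpace.IsSeparable E₀)
    {Ω : Type*} [MeasurableSpace Ω] {f : Ω → E} (hf : Measurable f) (hfE₀ : ∀ ω, f ω ∈ E₀)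
    {G : E → F} (hG : ContinuousOn G E₀) : Measurable fun ω => G (f ω) := by
  rw [hmF]
  refine measurable_generateFrom ?_
  rintro _ ⟨c, r, -, rfl⟩
  obtain ⟨V, hV, hGV⟩ := continuousOn_iff'.1 hG _ (Metric.isOpen_ball (x := c) (ε := r))
  have hpre : (fun ω => G (f ω)) ⁻¹' Metric.ball c r = f ⁻¹' V := by
    ext ω
    have := Set.ext_iff.1 hGV (f ω)
    simpa [hfE₀ ω] using this
  rw [hpre]
  exact measurableSet_preimage_of_isOpen hmE hsep hf hfE₀ hV

/-- Functions `φ n` on `D n` whose limits along sequences converging to points of a separable set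
`E₀` are given by `φ₀` have uniformly bounded, continuous and ball-measurable minorants which are
asymptotically at least `φ₀` on `E₀`. -/
lemma exists_continuous_measurable_minorant (hmE : ‹MeasurableSpace E› = ballSigma E)
    {E₀ : Set E} (hsep : TopologicalSpace.IsSeparable E₀) (hne : E₀.Nonempty)
    {D : ℕ → Set E} (hD : ∀ n, (D n).Nonempty) {φ : ℕ → E → ℝ} {φ₀ : E → ℝ} {C : ℝ}
    (hφ : ∀ n y, |φ n y| ≤ C) (hφ₀ : ∀ y, |φ₀ y| ≤ C)
    (hlim : ∀ y ∈ E₀, ∀ m : ℕ → ℕ, Tendsto m atTop atTop → ∀ z : ℕ → E,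
      (∀ j, z j ∈ D (m j)) → Tendsto z atTop (𝓝 y) →
      Tendsto (fun j => φ (m j) (z j)) atTop (𝓝 (φ₀ y))) :
    ∃ ψ : ℕ → E → ℝ, (∀ k, Continuous (ψ k)) ∧ (∀ k, Measurable (ψ k)) ∧
      (∀ k y, |ψ k y| ≤ C) ∧ (∀ k n, k ≤ n → ∀ y ∈ D n, ψ k y ≤ φ n y) ∧
      ∀ y ∈ E₀, ∀ c < φ₀ y, ∀ᶠ k in atTop, c < ψ k y := by
  obtain ⟨e, he⟩ := exists_seq_dist_lt_of_isSeparable hsep hne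
  let I : ℕ → Type _ := fun k => {p : ℕ × E // k ≤ p.1 ∧ p.2 ∈ D p.1}
  have : ∀ k, Nonempty (I k) := fun k =>
    ⟨⟨(k, (hD k).some), le_rfl, (hD k).some_mem⟩⟩
  let L : ℕ → E → ℝ := fun k y => ⨅ p : I k, φ p.1.1 p.1.2 + k * dist p.1.2 y
  have hC : 0 ≤ C := (abs_nonneg _).trans (hφ₀ (e 0))
  have hbdd : ∀ k y, BddBelow (Set.range fun p : I k => φ p.1.1 p.1.2 + k * dist p.1.2 y) := by
    intro k y
    refine ⟨-C, ?_⟩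
    rintro _ ⟨p, rfl⟩
    have := (abs_le.1 (hφ p.1.1 p.1.2)).1
    have : 0 ≤ k * dist p.1.2 y := by positivity
    dsimp only
    linarith
  have hLle : ∀ k n, k ≤ n → ∀ y, ∀ z ∈ D n, L k y ≤ φ n z + k * dist z y := fun k n hkn y z hz =>
    ciInf_le (hbdd k y) ⟨(n, z), hkn, hz⟩
  have hLlip : ∀ k y z, L k y ≤ L k z + k * dist y z := by
    intro k y z
    rw [← sub_le_iff_le_add]
    refine le_ciInf fun p => ?_
    have h := hLle k p.1.1 p.2.1 y p.1.2 p.2.2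
    nlinarith [mul_le_mul_of_nonneg_left (dist_triangle p.1.2 z y) (k.cast_nonneg (α := ℝ)),
      dist_comm y z]
  let S : ℕ → E → ℝ := fun k y => ⨆ i, L k (e i) - k * dist y (e i)
  have hSle : ∀ k y i, L k (e i) - k * dist y (e i) ≤ L k y := by
    intro k y i
    have := hLlip k (e i) y
    rw [dist_comm] at this
    linarith
  have hSbdd : ∀ k y, BddAbove (Set.range fun i => L k (e i) - k * dist y (e i)) := by
    intro k y
    refine ⟨L k y, ?_⟩
    rintro _ ⟨i, rfl⟩
    exact hSle k y i
  have hScont : ∀ k, Continuous (S k) := by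
    intro k
    refine (LipschitzWith.of_le_add_mul (k : NNReal) fun y z => ?_).continuous
    refine ciSup_le fun i => ?_
    have h := le_ciSup (hSbdd k z) i
    have hS : L k (e i) - k * dist z (e i) ≤ S k z := h
    rw [NNReal.coe_natCast]
    nlinarith [mul_le_mul_of_nonneg_left (dist_triangle z y (e i)) (k.cast_nonneg (α := ℝ)),
      dist_comm y z]
  have hSmeas : ∀ k, Measurable (S k) := fun k =>
    Measurable.iSup fun i => measurable_const.sub
      (measurable_const.mul (measurable_dist_of_eq_ballSigma hmE (e i)))
  refine ⟨fun k y => max (-C) (min C (S k y)),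
    fun k => continuous_const.max (continuous_const.min (hScont k)),
    fun k => measurable_const.max (measurable_const.min (hSmeas k)),
    fun k y => abs_le.2 ⟨le_max_left _ _, max_le (by linarith) (min_le_left _ _)⟩, ?_, ?_⟩
  · intro k n hkn y hy
    refine max_le (abs_le.1 (hφ n y)).1 ((min_le_right _ _).trans ((ciSup_le (hSle k y)).trans ?_))
    simpa using hLle k n hkn y y hy
  · intro y hy c hc
    obtain ⟨c', hcc', hc'⟩ := exists_between hc
    have hL : ∀ᶠ k in atTop, c' ≤ L k y := by
      by_contra hfreq
      rw [not_eventually] at hfreq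
      obtain ⟨κ, hκ, hκL⟩ := extraction_of_frequently_atTop hfreq
      have hex : ∀ j, ∃ p : I (κ j), φ p.1.1 p.1.2 + κ j * dist p.1.2 y < c' := fun j =>
        exists_lt_of_ciInf_lt (not_le.1 (hκL j))
      choose p hp using hex
      have hm : Tendsto (fun j => (p j).1.1) atTop atTop :=
        tendsto_atTop_mono (fun j => (p j).2.1) hκ.tendsto_atTop
      have hκR : Tendsto (fun j => (κ j : ℝ)) atTop atTop :=
        tendsto_natCast_atTop_atTop.comp hκ.tendsto_atTop
      have hz : Tendsto (fun j => (p j).1.2) atTop (𝓝 y) := by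
        rw [tendsto_iff_dist_tendsto_zero]
        refine squeeze_zero' (.of_forall fun _ => dist_nonneg) ?_
          (tendsto_const_nhds (x := c' + C) |>.div_atTop hκR)
        filter_upwards [hκR.eventually_gt_atTop 0] with j hj
        rw [le_div_iff₀ hj, mul_comm]
        linarith [hp j, (abs_le.1 (hφ (p j).1.1 (p j).1.2)).1]
      refine absurd (le_of_tendsto' (hlim y hy _ hm _ (fun j => (p j).2.2) hz) fun j => ?_)
        (not_le.2 hc')
      have : 0 ≤ κ j * dist (p j).1.2 y := by positivity
      linarith [hp j]
    filter_upwards [hL] with k hk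
    refine lt_max_of_lt_right (lt_min (hc.trans_le (abs_le.1 (hφ₀ y)).2) ?_)
    obtain ⟨i, hi⟩ := he y hy ((c' - c) / (2 * k + 1)) (div_pos (by linarith) (by positivity))
    refine lt_of_lt_of_le ?_ (le_ciSup (hSbdd k y) i)
    rw [lt_div_iff₀ (by positivity)] at hi
    nlinarith [hLlip k y (e i), dist_nonneg (x := y) (y := e i)]

/-- The lower half of the extended continuous mapping theorem for convergence in distribution
with respect to the open-ball σ-algebra. -/
lemma eventually_lt_integral_of_tendsto (hmE : ‹MeasurableSpace E› = ballSigma E)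
    {E₀ : Set E} (hsep : TopologicalSpace.IsSeparable E₀)
    {D : ℕ → Set E} (hD : ∀ n, (D n).Nonempty) {φ : ℕ → E → ℝ} {φ₀ : E → ℝ} {C : ℝ}
    (hφ : ∀ n y, |φ n y| ≤ C) (hφ₀ : ∀ y, |φ₀ y| ≤ C)
    (hlim : ∀ y ∈ E₀, ∀ m : ℕ → ℕ, Tendsto m atTop atTop → ∀ z : ℕ → E,
      (∀ j, z j ∈ D (m j)) → Tendsto z atTop (𝓝 y) →
      Tendsto (fun j => φ (m j) (z j)) atTop (𝓝 (φ₀ y)))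
    {Ω : ℕ → Type*} [∀ n, MeasurableSpace (Ω n)]
    (P : ∀ n, Measure (Ω n)) [∀ n, IsProbabilityMeasure (P n)]
    {Y : ∀ n, Ω n → E} (hY : ∀ n, Measurable (Y n)) (hYD : ∀ n ω, Y n ω ∈ D n)
    (hφY : ∀ n, Measurable fun ω => φ n (Y n ω))
    {Ω₀ : Type*} [MeasurableSpace Ω₀] (P₀ : Measure Ω₀) [IsProbabilityMeasure P₀]
    {Y₀ : Ω₀ → E} (hY₀ : Measurable Y₀) (hY₀E₀ : ∀ ω, Y₀ ω ∈ E₀)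
    (hφY₀ : Measurable fun ω => φ₀ (Y₀ ω))
    (hconv : ∀ f : E → ℝ, Continuous f → (∃ C, ∀ y, |f y| ≤ C) → Measurable f →
      Tendsto (fun n => ∫ ω, f (Y n ω) ∂(P n)) atTop (𝓝 (∫ ω, f (Y₀ ω) ∂P₀)))
    {c : ℝ} (hc : c < ∫ ω, φ₀ (Y₀ ω) ∂P₀) :
    ∀ᶠ n in atTop, c < ∫ ω, φ n (Y n ω) ∂(P n) := by
  obtain ⟨ω₀⟩ := nonempty_of_isProbabilityMeasure P₀
  obtain ⟨ψ, hψcont, hψmeas, hψC, hψle, hψlim⟩ :=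
    exists_continuous_measurable_minorant hmE hsep ⟨_, hY₀E₀ ω₀⟩ hD hφ hφ₀ hlim
  have hminC : ∀ k ω, |min (ψ k (Y₀ ω)) (φ₀ (Y₀ ω))| ≤ C := fun k ω =>
    abs_min_le_max_abs_abs.trans (max_le (hψC k _) (hφ₀ _))
  have hmin : Tendsto (fun k => ∫ ω, min (ψ k (Y₀ ω)) (φ₀ (Y₀ ω)) ∂P₀) atTop
      (𝓝 (∫ ω, φ₀ (Y₀ ω) ∂P₀)) := by
    refine tendsto_integral_of_dominated_convergence (fun _ => C)
      (fun k => (((hψmeas k).comp hY₀).min hφY₀).aestronglyMeasurable)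
      (integrable_const C) (fun k => .of_forall fun ω => ?_) (.of_forall fun ω => ?_)
    · exact hminC k ω
    · refine tendsto_order.2 ⟨fun b hb => ?_, fun b hb => .of_forall fun k => ?_⟩
      · filter_upwards [hψlim _ (hY₀E₀ ω) b hb] with k hk
        exact lt_min hk hb
      · exact (min_le_right _ _).trans_lt hb
  obtain ⟨k, hk⟩ := (hmin.eventually (lt_mem_nhds hc)).exists
  have hkψ : c < ∫ ω, ψ k (Y₀ ω) ∂P₀ :=
    hk.trans_le <| integral_mono
      (integrable_of_forall_abs_le P₀ (((hψmeas k).comp hY₀).min hφY₀) (hminC k))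
      (integrable_of_forall_abs_le P₀ ((hψmeas k).comp hY₀) fun _ => hψC _ _)
      fun ω => min_le_left _ _
  filter_upwards [(hconv (ψ k) (hψcont k) ⟨C, hψC k⟩ (hψmeas k)).eventually (lt_mem_nhds hkψ),
    eventually_ge_atTop k] with n hn hkn
  exact hn.trans_le <| integral_mono
    (integrable_of_forall_abs_le (P n) ((hψmeas k).comp (hY n)) fun _ => hψC _ _)
    (integrable_of_forall_abs_le (P n) (hφY n) fun _ => hφ _ _) fun ω => hψle k n hkn _ (hYD n ω)

end BallSigma

/-- **Functional delta-method, part (i)** (Theorem D.4(i)).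
Convergence in distribution° is expressed by testing against all bounded, continuous,
(ℬ°, Borel(ℝ))-measurable real-valued functions. -/
theorem delta_method_part_i
    {E : Type*} [NormedAddCommGroup E] [NormedSpace ℝ E]
    {F : Type*} [NormedAddCommGroup F] [NormedSpace ℝ F]
    [mE : MeasurableSpace E] (hmE : mE = ballSigma E)
    [mF : MeasurableSpace F] (hmF : mF = ballSigma F)
    (E₀ : Set E) (hE₀sep : TopologicalSpace.IsSeparable E₀) (hE₀meas : MeasurableSet E₀)
    (VH : Set E) (H : E → F) (x : E) (hx : x ∈ VH)
    (a : ℕ → ℝ) (ha_pos : ∀ n, 0 < a n) (ha_top : Tendsto a atTop atTop)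
    {Ω : ℕ → Type*} [∀ n, MeasurableSpace (Ω n)]
    (P : ∀ n, Measure (Ω n)) (hP : ∀ n, IsProbabilityMeasure (P n))
    (X : ∀ n, Ω n → E)
    {Ω₀ : Type*} [MeasurableSpace Ω₀] (P₀ : Measure Ω₀) (hP₀ : IsProbabilityMeasure P₀)
    (X₀ : Ω₀ → E) (hX₀meas : Measurable X₀) (hX₀mem : ∀ ω₀, X₀ ω₀ ∈ E₀)
    -- (a) `X_n` takes values only in `V_H`
    (hXa : ∀ n ω, X n ω ∈ VH)
    -- (b) `a_n (X_n − x)` is measurable and converges in distribution° to `X₀`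
    (hmeas : ∀ n, Measurable fun ω => a n • (X n ω - x))
    (hconv : ∀ f : E → ℝ, Continuous f → (∃ C, ∀ y, |f y| ≤ C) → Measurable f →
      Tendsto (fun n => ∫ ω, f (a n • (X n ω - x)) ∂(P n)) atTop
        (𝓝 (∫ ω₀, f (X₀ ω₀) ∂P₀)))
    -- (c) `a_n (H(X_n) − H(x))` is measurable
    (hmeasH : ∀ n, Measurable fun ω => a n • (H (X n ω) - H x))
    -- (d) quasi-Hadamard differentiability
    (H' : E → F) (hqH : QuasiHadamardAt VH H x E₀ H') :
    Measurable (fun ω₀ => H' (X₀ ω₀)) ∧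
    ∀ g : F → ℝ, Continuous g → (∃ C, ∀ y, |g y| ≤ C) → Measurable g →
      Tendsto (fun n => ∫ ω, g (a n • (H (X n ω) - H x)) ∂(P n)) atTop
        (𝓝 (∫ ω₀, g (H' (X₀ ω₀)) ∂P₀)) := by
  have hmeas₀ : Measurable fun ω₀ => H' (X₀ ω₀) :=
    measurable_comp_of_continuousOn_of_isSeparable hmE hmF hE₀sep hX₀meas hX₀mem hqH.1
  refine ⟨hmeas₀, fun g hg ⟨C, hC⟩ hgmeas => ?_⟩
  let D : ℕ → Set E := fun n => {y | x + (a n)⁻¹ • y ∈ VH}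
  let h : ℕ → E → F := fun n y => a n • (H (x + (a n)⁻¹ • y) - H x)
  have hD : ∀ n, (D n).Nonempty := fun n => ⟨0, by simpa [D] using hx⟩
  have hX : ∀ n ω, x + (a n)⁻¹ • (a n • (X n ω - x)) = X n ω := fun n ω => by
    rw [inv_smul_smul₀ (ha_pos n).ne', add_sub_cancel]
  have hhX : ∀ n ω, h n (a n • (X n ω - x)) = a n • (H (X n ω) - H x) := fun n ω => by
    simp only [h, hX]
  have hlim : ∀ y ∈ E₀, ∀ m : ℕ → ℕ, Tendsto m atTop atTop → ∀ z : ℕ → E,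
      (∀ j, z j ∈ D (m j)) → Tendsto z atTop (𝓝 y) →
      Tendsto (fun j => h (m j) (z j)) atTop (𝓝 (H' y)) := by
    intro y hy m hm z hz hzy
    have key := hqH.2 y hy z (fun j => (a (m j))⁻¹) (fun j => inv_pos.2 (ha_pos _))
      (tendsto_inv_atTop_zero.comp (ha_top.comp hm)) (tendsto_iff_norm_sub_tendsto_zero.1 hzy) hz
    rw [tendsto_iff_norm_sub_tendsto_zero]
    simpa only [inv_inv, norm_sub_rev (H' y)] using key
  have lower : ∀ f : F → ℝ, Continuous f → (∀ y, |f y| ≤ C) → Measurable f →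
      ∀ c < ∫ ω, f (H' (X₀ ω)) ∂P₀,
        ∀ᶠ n in atTop, c < ∫ ω, f (a n • (H (X n ω) - H x)) ∂(P n) := by
    intro f hf hfC hfmeas c hc
    have := eventually_lt_integral_of_tendsto hmE hE₀sep hD (φ := fun n y => f (h n y))
      (φ₀ := fun y => f (H' y)) (fun _ _ => hfC _) (fun _ => hfC _)
      (fun y hy m hm z hz hzy => (hf.tendsto _).comp (hlim y hy m hm z hz hzy)) P hmeas
      (fun n ω => by simpa only [D, Set.mem_ofPred_eq, hX] using hXa n ω)
      (fun n => by simpa only [hhX, Function.comp_def] using hfmeas.comp (hmeasH n)) P₀ hX₀meas hX₀mem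
      (hfmeas.comp hmeas₀) hconv hc
    simpa only [hhX] using this
  refine tendsto_order.2 ⟨lower g hg hC hgmeas, fun c hc => ?_⟩
  have := lower (fun y => -g y) hg.neg (fun y => by simpa using hC y) hgmeas.neg (-c)
    (by rw [integral_neg]; exact neg_lt_neg hc)
  filter_upwards [this] with n hn
  rw [integral_neg] at hn
  exact neg_lt_neg_iff.1 hn
end

section
/- Functional delta-method, part (ii) (Theorem D.4(ii)): In addition to the setting and assumptions (a)–(d) of the delta-method part (i), assume: (e) (Ω_n,ℱ_n,ℙ_n) = (Ω,ℱ,ℙ) for all n; (f) the quasi-Hadamard derivative Ḣ_x can be extended to a map Ḣ_x : E → Ẽ that is continuous at every point of E₀ and (ℬ°,ℬ̃°)-measurable; (g) the map h : Ẽ×Ẽ → Ẽ, h(x̃₁,x̃₂) := x̃₁ − x̃₂, is measurable from the open-ball σ-algebra of the metric d̄((x̃₁,x̃₂),(ỹ₁,ỹ₂)) = max{‖x̃₁−ỹ₁‖_Ẽ, ‖x̃₂−ỹ₂‖_Ẽ} on Ẽ×Ẽ to ℬ̃°. Then for every n the map ω ↦ ‖a_n(H(X_n(ω)) − H(x)) −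 Ḣ_x(a_n(X_n(ω) − x))‖_Ẽ is (ℱ,Borel(ℝ₊))-measurable, and for every ε > 0, ℙ[‖a_n(H(X_n) − H(x)) − Ḣ_x(a_n(X_n − x))‖_Ẽ ≥ ε] → 0 as n → ∞. -/
open MeasureTheory Filter Topology

theorem measurable_dist_const_of_ballSigma {E : Type*} [PseudoMetricSpace E]
    [mE : MeasurableSpace E] (hmE : mE = ballSigma E) (c : E) :
    Measurable fun z : E => dist z c := by
  refine measurable_of_Iio fun r => ?_
  rcases le_or_gt r 0 with hr | hr
  · convert MeasurableSet.empty
    ext z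
    simpa using hr.trans dist_nonneg
  · subst hmE
    exact MeasurableSpace.measurableSet_generateFrom ⟨c, r, hr, rfl⟩

theorem measurable_prodMk_ballSigma {Ω F G : Type*} [MeasurableSpace Ω] [PseudoMetricSpace F]
    [PseudoMetricSpace G] [mF : MeasurableSpace F] (hmF : mF = ballSigma F)
    [mG : MeasurableSpace G] (hmG : mG = ballSigma G) {u : Ω → F} {v : Ω → G}
    (hu : Measurable u) (hv : Measurable v) :
    @Measurable Ω (F × G) _ (ballSigma (F × G)) fun ω => (u ω, v ω) := by
  refine measurable_generateFrom ?_
  rintro _ ⟨⟨c, d⟩, r, hr, rfl⟩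
  rw [← ball_prod_same, Set.mk_preimage_prod]
  refine (hu ?_).inter (hv ?_)
  · subst hmF
    exact MeasurableSpace.measurableSet_generateFrom ⟨c, r, hr, rfl⟩
  · subst hmG
    exact MeasurableSpace.measurableSet_generateFrom ⟨d, r, hr, rfl⟩

/-- Near a point of `E₀`, the difference quotients are eventually uniformly close to the
derivative, on the set where they are defined. -/
theorem QuasiHadamardAt.exists_ball_norm_sub_lt {E F : Type*}
    [NormedAddCommGroup E] [NormedSpace ℝ E] [NormedAddCommGroup F] [NormedSpace ℝ F]
    {VH : Set E} {H : E → F} {x : E} {E₀ : Set E} {H' : E → F}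
    (hqH : QuasiHadamardAt VH H x E₀ H') {a : ℕ → ℝ} (ha_pos : ∀ n, 0 < a n)
    (ha_top : Tendsto a atTop atTop) {z₀ : E} (hz₀ : z₀ ∈ E₀) (hcont : ContinuousAt H' z₀)
    {ε : ℝ} (hε : 0 < ε) :
    ∃ δ > 0, ∃ N : ℕ, ∀ n ≥ N, ∀ z ∈ Metric.ball z₀ δ, x + (a n)⁻¹ • z ∈ VH →
      ‖a n • (H (x + (a n)⁻¹ • z) - H x) - H' z‖ < ε := by
  by_contra! hcon
  choose n hn z hz hzV hbad using fun k : ℕ =>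
    hcon (1 / ((k : ℝ) + 1)) Nat.one_div_pos_of_nat k
  have hz_lim : Tendsto z atTop (𝓝 z₀) := by
    rw [tendsto_iff_dist_tendsto_zero]
    exact squeeze_zero (fun _ => dist_nonneg) (fun k => (Metric.mem_ball.1 (hz k)).le)
      tendsto_one_div_add_atTop_nhds_zero_nat
  have ha_lim : Tendsto (fun k => a (n k)) atTop atTop :=
    ha_top.comp (tendsto_atTop_mono hn tendsto_id)
  have hquot := hqH.2 z₀ hz₀ z (fun k => (a (n k))⁻¹) (fun k => inv_pos.2 (ha_pos _))
    (tendsto_inv_atTop_zero.comp ha_lim) (tendsto_iff_norm_sub_tendsto_zero.1 hz_lim) hzV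
  have hder : Tendsto (fun k => ‖H' (z k) - H' z₀‖) atTop (𝓝 0) :=
    tendsto_iff_norm_sub_tendsto_zero.1 (hcont.tendsto.comp hz_lim)
  have hsum := hquot.add hder
  rw [add_zero] at hsum
  obtain ⟨k, hk⟩ := (hsum.eventually_lt_const hε).exists
  refine (hbad k).not_gt (lt_of_le_of_lt ?_ hk)
  simp only [inv_inv]
  rw [norm_sub_rev (H' z₀), norm_sub_rev (H' (z k))]
  exact norm_sub_le_norm_sub_add_norm_sub _ _ _

/-- A sequence of Lipschitz bumps supported in the union of the first `K` balls and converging to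
one on the union of all balls. -/
noncomputable def ballBump {E : Type*} [PseudoMetricSpace E] (c : ℕ → E) (δ : ℕ → ℝ) (K : ℕ)
    (z : E) : ℝ :=
  min 1 (K * ∑ k ∈ Finset.range K, max 0 (δ k - dist z (c k)))

section ballBump

variable {E : Type*} [PseudoMetricSpace E] (c : ℕ → E) (δ : ℕ → ℝ) (K : ℕ)

theorem ballBump_nonneg (z : E) : 0 ≤ ballBump c δ K z :=
  le_min zero_le_one <| mul_nonneg K.cast_nonneg <|
    Finset.sum_nonneg fun _ _ => le_max_left _ _

theorem ballBump_le_one (z : E) : ballBump c δ K z ≤ 1 := min_le_left _ _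

theorem abs_ballBump_le_one (z : E) : |ballBump c δ K z| ≤ 1 := by
  rw [abs_of_nonneg (ballBump_nonneg c δ K z)]
  exact ballBump_le_one c δ K z

theorem continuous_ballBump : Continuous (ballBump c δ K) := by
  unfold ballBump
  fun_prop

theorem measurable_ballBump [mE : MeasurableSpace E] (hmE : mE = ballSigma E) :
    Measurable (ballBump c δ K) := by
  have hdist := fun k => measurable_dist_const_of_ballSigma hmE (c k)
  unfold ballBump
  fun_prop

variable {c δ K}

theorem ballBump_eq_zero {z : E} (hz : ∀ k < K, z ∉ Metric.ball (c k) (δ k)) :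
    ballBump c δ K z = 0 := by
  have hsum : ∑ k ∈ Finset.range K, max 0 (δ k - dist z (c k)) = 0 :=
    Finset.sum_eq_zero fun k hk => max_eq_left <| by
      simpa using hz k (Finset.mem_range.1 hk)
  simp [ballBump, hsum]

theorem tendsto_ballBump {z : E} {k : ℕ} (hz : z ∈ Metric.ball (c k) (δ k)) :
    Tendsto (fun K => ballBump c δ K z) atTop (𝓝 1) := by
  have hpos : 0 < δ k - dist z (c k) := sub_pos.2 hz
  refine tendsto_const_nhds.congr' ?_
  have hlarge : ∀ᶠ K : ℕ in atTop, 1 ≤ (K : ℝ) * (δ k - dist z (c k)) :=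
    (tendsto_natCast_atTop_atTop.atTop_mul_const hpos).eventually_ge_atTop 1
  filter_upwards [hlarge, eventually_gt_atTop k] with K hK hkK
  refine (min_eq_left (hK.trans ?_)).symm
  gcongr
  exact (le_max_right _ _).trans <|
    Finset.single_le_sum (f := fun k => max 0 (δ k - dist z (c k)))
      (fun _ _ => le_max_left _ _) (Finset.mem_range.2 hkK)

end ballBump

/-- **Functional delta-method, part (ii)** (Theorem D.4(ii)).
Note that on `F × F` the product metric is `d̄((x̃₁,x̃₂),(ỹ₁,ỹ₂)) =
max{‖x̃₁−ỹ₁‖, ‖x̃₂−ỹ₂‖}`, so `ballSigma (F × F)` is the open-ball σ-algebra of `d̄`. -/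
theorem delta_method_part_ii
    {E : Type*} [NormedAddCommGroup E] [NormedSpace ℝ E]
    {F : Type*} [NormedAddCommGroup F] [NormedSpace ℝ F]
    [mE : MeasurableSpace E] (hmE : mE = ballSigma E)
    [mF : MeasurableSpace F] (hmF : mF = ballSigma F)
    (E₀ : Set E) (hE₀sep : TopologicalSpace.IsSeparable E₀) (hE₀meas : MeasurableSet E₀)
    (VH : Set E) (H : E → F) (x : E) (hx : x ∈ VH)
    (a : ℕ → ℝ) (ha_pos : ∀ n, 0 < a n) (ha_top : Tendsto a atTop atTop)
    -- (e) all the `X_n` are defined on a common probability space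
    {Ω : Type*} [MeasurableSpace Ω] (P : Measure Ω) [IsProbabilityMeasure P]
    (X : ℕ → Ω → E)
    {Ω₀ : Type*} [MeasurableSpace Ω₀] (P₀ : Measure Ω₀) (hP₀ : IsProbabilityMeasure P₀)
    (X₀ : Ω₀ → E) (hX₀meas : Measurable X₀) (hX₀mem : ∀ ω₀, X₀ ω₀ ∈ E₀)
    -- (a) `X_n` takes values only in `V_H`
    (hXa : ∀ n ω, X n ω ∈ VH)
    -- (b) `a_n (X_n − x)` is measurable and converges in distribution° to `X₀`
    (hmeas : ∀ n, Measurable fun ω => a n • (X n ω - x))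
    (hconv : ∀ f : E → ℝ, Continuous f → (∃ C, ∀ y, |f y| ≤ C) → Measurable f →
      Tendsto (fun n => ∫ ω, f (a n • (X n ω - x)) ∂P) atTop
        (𝓝 (∫ ω₀, f (X₀ ω₀) ∂P₀)))
    -- (c) `a_n (H(X_n) − H(x))` is measurable
    (hmeasH : ∀ n, Measurable fun ω => a n • (H (X n ω) - H x))
    -- (d) quasi-Hadamard differentiability
    (H' : E → F) (hqH : QuasiHadamardAt VH H x E₀ H')
    -- (f) the derivative extends to a map `E → F` (the extension is `H'` itself) that is
    -- continuous at every point of `E₀` and (ℬ°, ℬ̃°)-measurable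
    (hH'contAt : ∀ y ∈ E₀, ContinuousAt H' y) (hH'meas : Measurable H')
    -- (g) subtraction is measurable from the open-ball σ-algebra of the max-metric on `F × F`
    (hsub : @Measurable (F × F) F (ballSigma (F × F)) mF (fun p => p.1 - p.2)) :
    (∀ n, Measurable fun ω => ‖a n • (H (X n ω) - H x) - H' (a n • (X n ω - x))‖) ∧
    ∀ ε : ℝ, 0 < ε →
      Tendsto (fun n => P {ω | ε ≤ ‖a n • (H (X n ω) - H x) - H' (a n • (X n ω - x))‖})
        atTop (𝓝 0) := by
  have hnorm : ∀ n, Measurable fun ω =>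
      ‖a n • (H (X n ω) - H x) - H' (a n • (X n ω - x))‖ := by
    intro n
    have hpair := measurable_prodMk_ballSigma hmF hmF (hmeasH n) (hH'meas.comp (hmeas n))
    have hdiff := hsub.comp hpair
    simpa only [Function.comp_def, dist_zero_right] using
      (measurable_dist_const_of_ballSigma hmF 0).comp hdiff
  refine ⟨hnorm, fun ε hε => ?_⟩
  have hlocal : ∀ z₀ : E, ∃ δ > 0, ∃ N : ℕ, z₀ ∈ E₀ → ∀ n ≥ N, ∀ z ∈ Metric.ball z₀ δ,
      x + (a n)⁻¹ • z ∈ VH → ‖a n • (H (x + (a n)⁻¹ • z) - H x) - H' z‖ < ε := by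
    intro z₀
    by_cases hz₀ : z₀ ∈ E₀
    · obtain ⟨δ, hδ, N, h⟩ :=
        hqH.exists_ball_norm_sub_lt ha_pos ha_top hz₀ (hH'contAt z₀ hz₀) hε
      exact ⟨δ, hδ, N, fun _ => h⟩
    · exact ⟨1, one_pos, 0, fun h => absurd h hz₀⟩
  choose δ hδ N hlocal using hlocal
  have : SecondCountableTopology E₀ := hE₀sep.secondCountableTopology
  have hLin : IsLindelof E₀ := isLindelof_iff_lindelofSpace.2 inferInstance
  obtain ⟨t, ht, htE₀, hcover⟩ := hLin.elim_nhds_subcover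
    (fun z => Metric.ball z (δ z)) fun z _ => Metric.ball_mem_nhds z (hδ z)
  obtain ⟨ω₀⟩ := nonempty_of_isProbabilityMeasure P₀
  have ht_ne : t.Nonempty := by
    obtain ⟨z, hz, -⟩ := Set.mem_iUnion₂.1 (hcover (hX₀mem ω₀))
    exact ⟨z, hz⟩
  obtain ⟨c, rfl⟩ := ht.exists_eq_range ht_ne
  have hc : ∀ k, c k ∈ E₀ := fun k => htE₀ _ (Set.mem_range_self k)
  set g : ℕ → E → ℝ := ballBump c fun k => δ (c k)
  have hg_meas : ∀ K, Measurable (g K) := fun K => measurable_ballBump c _ K hmE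
  have hg_lim : Tendsto (fun K => ∫ ω₀, g K (X₀ ω₀) ∂P₀) atTop (𝓝 1) := by
    have h := tendsto_integral_of_dominated_convergence (μ := P₀) (fun _ => (1 : ℝ))
      (F := fun K ω₀ => g K (X₀ ω₀)) (f := fun _ => (1 : ℝ))
      (fun K => ((hg_meas K).comp hX₀meas).aestronglyMeasurable) (integrable_const _)
      (fun K => ae_of_all _ fun ω₀ => abs_ballBump_le_one c _ K (X₀ ω₀))
      (ae_of_all _ fun ω₀ => by
        obtain ⟨_, ⟨k, rfl⟩, hk⟩ := Set.mem_iUnion₂.1 (hcover (hX₀mem ω₀))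
        exact tendsto_ballBump hk)
    simpa using h
  have hbad : ∀ K, ∀ᶠ n in atTop,
      P.real {ω | ε ≤ ‖a n • (H (X n ω) - H x) - H' (a n • (X n ω - x))‖} ≤
        1 - ∫ ω, g K (a n • (X n ω - x)) ∂P := by
    intro K
    have hN : ∀ᶠ n in atTop, ∀ k < K, N (c k) ≤ n :=
      (Set.finite_lt_nat K).eventually_all.2 fun k _ => eventually_ge_atTop _
    filter_upwards [hN] with n hn
    have hint : Integrable (fun ω => g K (a n • (X n ω - x))) P :=
      Integrable.of_bound ((hg_meas K).comp (hmeas n)).aestronglyMeasurable 1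
        (ae_of_all _ fun ω => abs_ballBump_le_one c _ K _)
    have hset := measurableSet_le measurable_const (hnorm n) (f := fun _ => ε)
    have hone : ∫ _ : Ω, (1 : ℝ) ∂P = 1 := by simp
    rw [← integral_indicator_one hset, ← hone, ← integral_sub (integrable_const _) hint]
    refine integral_mono ((integrable_const (1 : ℝ)).indicator hset)
      ((integrable_const _).sub hint) fun ω => ?_
    refine Set.indicator_apply_le' (fun hω => ?_)
      (fun _ => sub_nonneg.2 (ballBump_le_one c _ K _))
    have hX : x + (a n)⁻¹ • a n • (X n ω - x) = X n ω := by
      rw [inv_smul_smul₀ (ha_pos n).ne', add_sub_cancel]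
    have hzero : g K (a n • (X n ω - x)) = 0 := ballBump_eq_zero fun k hk hmem => by
      have h := hlocal (c k) (hc k) n (hn k hk) _ hmem (by rw [hX]; exact hXa n ω)
      rw [hX] at h
      exact h.not_ge hω
    simp [hzero]
  refine (ENNReal.tendsto_toReal_iff (fun n => measure_ne_top P _) ENNReal.zero_ne_top).1 ?_
  refine tendsto_order.2 ⟨fun b hb => Eventually.of_forall fun n =>
    hb.trans_le ENNReal.toReal_nonneg, fun b hb => ?_⟩
  obtain ⟨K, hK⟩ := (hg_lim.eventually_const_lt (sub_lt_self 1 hb)).exists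
  filter_upwards [hbad K, (hconv (g K) (continuous_ballBump c _ K)
    ⟨1, abs_ballBump_le_one c _ K⟩ (hg_meas K)).eventually_const_lt hK] with n hn hn'
  exact hn.trans_lt (by linarith)
end

section
/- Delta-method for the bootstrap, almost-sure version (Theorem 3.1(ii)): Assume (a) a_n(T̂_n − θ) takes values only in E, is (ℱ,ℬ°)-measurable, and converges in distribution° to an (E,ℬ°)-valued random variable ξ on a probability space (Ω₀,ℱ₀,ℙ₀) with ξ(Ω₀) ⊆ E₀; (b) f(T̂_n) : Ω → Ẽ is (ℱ,ℬ̃)-measurable; (c) f is quasi-Hadamard differentiable at θ tangentially to E₀⟨E⟩ with quasi-Hadamard derivative ḟ_θ; (d) ḟ_θ can be extended from E₀ to a map ḟ_θ : E → Ẽ that is linear, (ℬ°,ℬ̃)-measurable, and continuous at every point of E₀; (e) f(T̂_n*) : Ω̄ → Ẽ is (ℱ̄,ℬ̃)-measurable; (f) a_n(T̂_n* − θ) and a_n(T̂_n* − T̂_n) take values only in E and are (ℱ̄,ℬ°)-measurable, and for ℙ-almost every ω ∈ Ω, a_n(T̂_n*(ω,·) − T̂_n(ω)) converges in distribution° to ξ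 in (E,ℬ°,‖·‖_E). Then a_n(f(T̂_n*) − f(T̂_n)) is (ℱ̄,ℬ̃)-measurable, ḟ_θ(ξ) is (ℱ₀,ℬ̃)-measurable, and for every δ > 0, ℙ[{ω ∈ Ω : d̃_BL(P̃_n(ω,·), law(ḟ_θ(ξ))) ≥ δ}] → 0 as n → ∞, where P̃_n(ω,A) := ℙ'[{ω' ∈ Ω' : a_n(f(T̂_n*(ω,ω')) − f(T̂_n(ω))) ∈ A}] for A ∈ ℬ̃. -/
open MeasureTheory Filter Topology

/-- The bounded Lipschitz distance between two measures, built from the class of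
measurable functions bounded by `1` and Lipschitz with constant `1`. -/
noncomputable def dBL {G : Type*} [PseudoMetricSpace G] [MeasurableSpace G]
    (μ ν : Measure G) : ℝ :=
  sSup ((fun g => |∫ x, g x ∂μ - ∫ x, g x ∂ν|) ''
    {g : G → ℝ | Measurable g ∧ (∀ x, |g x| ≤ 1) ∧ ∀ x y, |g x - g y| ≤ dist x y})

lemma measurableSet_ball_of_eq_ballSigma {E : Type*} [PseudoMetricSpace E] {mE : MeasurableSpace E}
    (hmE : mE = ballSigma E) (x : E) (r : ℝ) : MeasurableSet (Metric.ball x r) := by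
  subst hmE
  rcases le_or_gt r 0 with hr | hr
  · rw [Metric.ball_eq_empty.2 hr]
    exact @MeasurableSet.empty E (ballSigma E)
  · exact MeasurableSpace.measurableSet_generateFrom ⟨x, r, hr, rfl⟩

section BallMeasurability

variable {E : Type*} [PseudoMetricSpace E] [MeasurableSpace E]

lemma measurable_dist_left_of_measurableSet_ball
    (hball : ∀ (x : E) (r : ℝ), MeasurableSet (Metric.ball x r)) (x : E) :
    Measurable fun y => dist y x :=
  measurable_of_Iio fun r => hball x r

lemma measurableSet_biUnion_ball
    (hball : ∀ (x : E) (r : ℝ), MeasurableSet (Metric.ball x r)) (A : Finset E) (r : E → ℝ) :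
    MeasurableSet (⋃ x ∈ A, Metric.ball x (r x)) :=
  A.measurableSet_biUnion fun _ _ => hball _ _

/-- A random variable with values in a separable set lies, up to small probability, in a finite
union of balls from any prescribed cover by balls centred in that set. -/
lemma exists_finset_measureReal_notMem_biUnion_ball_lt
    (hball : ∀ (x : E) (r : ℝ), MeasurableSet (Metric.ball x r))
    {s : Set E} (hs : TopologicalSpace.IsSeparable s)
    {Ω : Type*} [MeasurableSpace Ω] (P : Measure Ω) [IsFiniteMeasure P]
    {ξ : Ω → E} (hξ : Measurable ξ) (hξs : ∀ ω, ξ ω ∈ s)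
    {r : E → ℝ} (hr : ∀ x ∈ s, 0 < r x) {η : ℝ} (hη : 0 < η) :
    ∃ A : Finset E, ↑A ⊆ s ∧ P.real {ω | ξ ω ∉ ⋃ x ∈ A, Metric.ball x (r x)} < η := by
  classical
  have := hs.separableSpace
  have : SecondCountableTopology s := UniformSpace.secondCountable_of_separable s
  obtain ⟨c, hc, hcov⟩ := TopologicalSpace.countable_cover_nhds
    (f := fun x : s => Metric.ball x (r x)) fun x => Metric.ball_mem_nhds x (hr x x.2)
  have := hc.to_subtype
  let B : Finset c → Set Ω :=
    fun A => {ω | ξ ω ∉ ⋃ x ∈ A, Metric.ball ((x : s) : E) (r (x : s))}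
  have hB : ∀ A, MeasurableSet (B A) := fun A =>
    (hξ (A.measurableSet_biUnion fun _ _ => hball _ _)).compl
  have hanti : Antitone B := fun A A' h ω hω hmem =>
    hω (Set.biUnion_subset_biUnion_left (fun _ hx => h hx) hmem)
  have hempty : ⋂ A, B A = ∅ := by
    refine Set.eq_empty_of_forall_notMem fun ω hω => ?_
    have hmem : (⟨ξ ω, hξs ω⟩ : s) ∈ ⋃ x ∈ c, Metric.ball x (r x) := hcov ▸ Set.mem_univ _
    simp only [Set.mem_iUnion] at hmem
    obtain ⟨x, hx, hmem⟩ := hmem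
    refine Set.mem_iInter.1 hω {⟨x, hx⟩} ?_
    simpa [Subtype.dist_eq] using hmem
  have hlim := tendsto_measure_iInter_atTop (μ := P) (fun A => (hB A).nullMeasurableSet) hanti
    ⟨∅, measure_ne_top _ _⟩
  rw [hempty, measure_empty] at hlim
  have hlim' := (ENNReal.tendsto_toReal ENNReal.zero_ne_top).comp hlim
  obtain ⟨A, hA⟩ := ((tendsto_order.1 hlim').2 η (by simpa using hη)).exists
  refine ⟨A.image fun x : c => ((x : s) : E), ?_, ?_⟩
  · intro x hx
    simp only [Finset.coe_image, Set.mem_image] at hx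
    obtain ⟨y, -, rfl⟩ := hx
    exact y.1.2
  · simpa [B, Measure.real] using hA

/-- Portmanteau inequality for finite unions of balls. -/
lemma eventually_measureReal_notMem_biUnion_ball_lt
    (hball : ∀ (x : E) (r : ℝ), MeasurableSet (Metric.ball x r))
    {Ω Ω₀ : Type*} [MeasurableSpace Ω] [MeasurableSpace Ω₀]
    (P : Measure Ω) [IsProbabilityMeasure P] (P₀ : Measure Ω₀) [IsProbabilityMeasure P₀]
    {Z : ℕ → Ω → E} (hZ : ∀ n, Measurable (Z n)) {ξ : Ω₀ → E} (hξ : Measurable ξ)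
    (hconv : ∀ g : E → ℝ, Continuous g → (∃ C, ∀ y, |g y| ≤ C) → Measurable g →
      Tendsto (fun n => ∫ ω, g (Z n ω) ∂P) atTop (𝓝 (∫ ω₀, g (ξ ω₀) ∂P₀)))
    (A : Finset E) (r : E → ℝ) {η : ℝ}
    (hη : P₀.real {ω | ξ ω ∉ ⋃ x ∈ A, Metric.ball x (r x)} < η) :
    ∀ᶠ n in atTop, P.real {ω | Z n ω ∉ ⋃ x ∈ A, Metric.ball x (r x)} < η := by
  set U : Set E := ⋃ x ∈ A, Metric.ball x (r x) with hU
  have hUm : MeasurableSet U := measurableSet_biUnion_ball hball A r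
  let h : E → ℝ := fun y => ∑ x ∈ A, max (r x - dist y x) 0
  have hh0 : ∀ y, 0 ≤ h y := fun y => Finset.sum_nonneg fun _ _ => le_max_right _ _
  have hhc : Continuous h := by fun_prop
  have hhm : Measurable h := Finset.measurable_sum _ fun x _ =>
    (measurable_const.sub (measurable_dist_left_of_measurableSet_ball hball x)).max
      measurable_const
  have hhU : ∀ y ∈ U, 0 < h y := by
    intro y hy
    simp only [hU, Set.mem_iUnion] at hy
    obtain ⟨x, hx, hy⟩ := hy
    refine (lt_max_of_lt_left (sub_pos.2 hy)).trans_le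
      (Finset.single_le_sum (f := fun x => max (r x - dist y x) 0)
        (fun _ _ => le_max_right _ _) hx)
  have hhUc : ∀ y ∉ U, h y = 0 := by
    intro y hy
    refine Finset.sum_eq_zero fun x hx => max_eq_right ?_
    simp only [hU, Set.mem_iUnion, not_exists, Metric.mem_ball, not_lt] at hy
    linarith [hy x hx]
  let g : ℕ → E → ℝ := fun k y => 1 - min 1 (k * h y)
  have hg0 : ∀ k y, 0 ≤ g k y := fun k y => sub_nonneg.2 (min_le_left _ _)
  have hg1 : ∀ k y, g k y ≤ 1 := fun k y =>
    sub_le_self _ (le_min zero_le_one (mul_nonneg k.cast_nonneg (hh0 y)))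
  have hgabs : ∀ k y, |g k y| ≤ 1 := fun k y => by
    rw [abs_of_nonneg (hg0 k y)]; exact hg1 k y
  have hgc : ∀ k, Continuous (g k) := fun k => by fun_prop
  have hgm : ∀ k, Measurable (g k) := fun k =>
    measurable_const.sub (measurable_const.min (measurable_const.mul hhm))
  have hlim : Tendsto (fun k => ∫ ω, g k (ξ ω) ∂P₀) atTop
      (𝓝 (∫ ω, (ξ ⁻¹' Uᶜ).indicator 1 ω ∂P₀)) := by
    refine tendsto_integral_of_dominated_convergence (fun _ => (1 : ℝ))
      (fun k => ((hgm k).comp hξ).aestronglyMeasurable) (integrable_const _)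
      (fun k => ae_of_all _ fun ω => hgabs k (ξ ω)) (ae_of_all _ fun ω => ?_)
    by_cases hω : ξ ω ∈ U
    · rw [Set.indicator_of_notMem (by simpa using hω)]
      refine tendsto_const_nhds.congr' ?_
      have : Tendsto (fun k : ℕ => (k : ℝ) * h (ξ ω)) atTop atTop :=
        tendsto_natCast_atTop_atTop.atTop_mul_const (hhU _ hω)
      filter_upwards [this.eventually_ge_atTop 1] with k hk
      simp [g, min_eq_left hk]
    · rw [Set.indicator_of_mem (by simpa using hω)]
      refine tendsto_const_nhds.congr fun k => ?_
      simp [g, hhUc _ hω]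
  rw [integral_indicator_one (hξ hUm.compl)] at hlim
  obtain ⟨k, hk⟩ := ((tendsto_order.1 hlim).2 η hη).exists
  filter_upwards [(tendsto_order.1 (hconv (g k) (hgc k) ⟨1, hgabs k⟩ (hgm k))).2 η hk] with n hn
  refine lt_of_le_of_lt ?_ hn
  change P.real (Z n ⁻¹' Uᶜ) ≤ _
  rw [← integral_indicator_one (hZ n hUm.compl)]
  refine integral_mono ((integrable_const 1).indicator (hZ n hUm.compl))
    (Integrable.of_bound ((hgm k).comp (hZ n)).aestronglyMeasurable 1
      (ae_of_all _ fun ω => hgabs k _)) fun ω => ?_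
  refine Set.indicator_le' (fun ω hω => ?_) (fun ω _ => hg0 k _) ω
  simp [g, hhUc _ hω]

end BallMeasurability

lemma abs_integral_sub_sum_mul_integral_le {F : Type*} [MeasurableSpace F] (μ : Measure F)
    [IsProbabilityMeasure μ] {ι : Type*} (A : Finset ι) {φ : ι → F → ℝ}
    (hφ : ∀ i, Integrable (φ i) μ) {g : F → ℝ} (hg : Integrable g μ) (c : ι → ℝ) {C : ℝ}
    (h : ∀ y, |g y - ∑ i ∈ A, c i * φ i y| ≤ C + (1 - ∑ i ∈ A, φ i y)) :
    |∫ y, g y ∂μ - ∑ i ∈ A, c i * ∫ y, φ i y ∂μ| ≤ C + (1 - ∑ i ∈ A, ∫ y, φ i y ∂μ) := by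
  have hs : Integrable (fun y => ∑ i ∈ A, φ i y) μ := integrable_finsetSum _ fun i _ => hφ i
  have hcs : Integrable (fun y => ∑ i ∈ A, c i * φ i y) μ :=
    integrable_finsetSum _ fun i _ => (hφ i).const_mul _
  have e1 : ∑ i ∈ A, c i * ∫ y, φ i y ∂μ = ∫ y, ∑ i ∈ A, c i * φ i y ∂μ := by
    rw [integral_finsetSum _ fun i _ => (hφ i).const_mul _]
    simp_rw [integral_const_mul]
  have e2 : C + (1 - ∑ i ∈ A, ∫ y, φ i y ∂μ) = ∫ y, (C + (1 - ∑ i ∈ A, φ i y)) ∂μ := by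
    rw [integral_add (integrable_const _) (by exact (integrable_const _).sub hs),
      integral_sub (integrable_const _) hs, integral_finsetSum _ fun i _ => hφ i]
    simp
  rw [e1, e2, ← integral_sub hg hcs]
  exact abs_integral_le_integral_abs.trans
    (integral_mono (hg.sub hcs).abs ((integrable_const _).add ((integrable_const _).sub hs)) h)

/-- On a separable metric space, the bounded Lipschitz distance to a fixed probability measure is
controlled by finitely many bounded continuous test functions, up to an arbitrarily small error. -/
lemma exists_finset_abs_integral_sub_le {F : Type*} [PseudoMetricSpace F]
    [TopologicalSpace.SeparableSpace F] [MeasurableSpace F] [BorelSpace F]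
    (ρ : Measure F) [IsProbabilityMeasure ρ] {ε : ℝ} (hε : 0 < ε) :
    ∃ (A : Finset F) (φ : F → F → ℝ), (∀ x, Continuous (φ x)) ∧ (∀ x y, |φ x y| ≤ 2) ∧
      ∀ (μ : Measure F) [IsProbabilityMeasure μ] (g : F → ℝ), Measurable g → (∀ x, |g x| ≤ 1) →
        (∀ x y, |g x - g y| ≤ dist x y) →
        |∫ y, g y ∂μ - ∫ y, g y ∂ρ| ≤
          6 * ε + 2 * ∑ x ∈ A, |∫ y, φ x y ∂μ - ∫ y, φ x y ∂ρ| := by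
  obtain ⟨A, -, hA⟩ := exists_finset_measureReal_notMem_biUnion_ball_lt
    (fun (x : F) (r : ℝ) => measurableSet_ball)
    (TopologicalSpace.isSeparable_univ_iff.2 ‹_›) ρ
    measurable_id (fun _ => Set.mem_univ _) (r := fun _ => ε) (fun _ _ => hε) hε
  let ψ : F → F → ℝ := fun x y => max (2 * ε - dist y x) 0
  let S : F → ℝ := fun y => ∑ x ∈ A, ψ x y
  let φ : F → F → ℝ := fun x y => ψ x y / max ε (S y)
  have hψ0 : ∀ x y, 0 ≤ ψ x y := fun _ _ => le_max_right _ _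
  have hD : ∀ y, 0 < max ε (S y) := fun y => lt_max_of_lt_left hε
  have hφ0 : ∀ x y, 0 ≤ φ x y := fun x y => div_nonneg (hψ0 x y) (hD y).le
  have hφ2 : ∀ x y, |φ x y| ≤ 2 := fun x y => by
    rw [abs_of_nonneg (hφ0 x y)]
    refine (div_le_iff₀ (hD y)).2 (max_le ?_ (by linarith [hD y]))
    linarith [le_max_left ε (S y), dist_nonneg (x := y) (y := x)]
  have hSc : Continuous S := by fun_prop
  have hφc : ∀ x, Continuous (φ x) := fun x =>
    Continuous.div (by fun_prop) (continuous_const.max hSc) fun y => (hD y).ne'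
  have hsum : ∀ y, ∑ x ∈ A, φ x y = S y / max ε (S y) := fun y =>
    (Finset.sum_div _ _ _).symm
  have hsum1 : ∀ y, ∑ x ∈ A, φ x y ≤ 1 := fun y => by
    rw [hsum]
    exact (div_le_one (hD y)).2 (le_max_right _ _)
  have hsumU : ∀ y ∈ ⋃ x ∈ A, Metric.ball x ε, ∑ x ∈ A, φ x y = 1 := fun y hy => by
    simp only [Set.mem_iUnion, Metric.mem_ball] at hy
    obtain ⟨x, hx, hy⟩ := hy
    have h1 : ε ≤ ψ x y := le_max_of_le_left (by linarith)
    have h2 : ψ x y ≤ S y :=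
      Finset.single_le_sum (f := fun x => ψ x y) (fun _ _ => hψ0 _ _) hx
    rw [hsum, max_eq_right (h1.trans h2)]
    exact div_self (hε.trans_le (h1.trans h2)).ne'
  have hint : ∀ (μ : Measure F) [IsProbabilityMeasure μ] (x : F), Integrable (φ x) μ :=
    fun μ _ x => Integrable.of_bound (hφc x).measurable.aestronglyMeasurable 2
      (ae_of_all _ (hφ2 x))
  have hρ : 1 - ∑ x ∈ A, ∫ y, φ x y ∂ρ ≤ ε := by
    have hm : MeasurableSet (⋃ x ∈ A, Metric.ball x ε)ᶜ :=
      (A.measurableSet_biUnion fun _ _ => measurableSet_ball).compl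
    have e : 1 - ∑ x ∈ A, ∫ y, φ x y ∂ρ = ∫ y, (1 - ∑ x ∈ A, φ x y) ∂ρ := by
      rw [integral_sub (integrable_const _) (integrable_finsetSum _ fun x _ => hint ρ x),
        integral_finsetSum _ fun x _ => hint ρ x]
      simp
    rw [e]
    refine le_trans ?_ hA.le
    change _ ≤ ρ.real (⋃ x ∈ A, Metric.ball x ε)ᶜ
    rw [← integral_indicator_one hm]
    refine integral_mono
      ((integrable_const _).sub (integrable_finsetSum _ fun x _ => hint ρ x))
      ((integrable_const 1).indicator hm) fun y => ?_
    by_cases hy : y ∈ ⋃ x ∈ A, Metric.ball x ε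
    · rw [Set.indicator_of_notMem (by simpa using hy)]
      simp [hsumU y hy]
    · rw [Set.indicator_of_mem hy]
      simpa using Finset.sum_nonneg fun x _ => hφ0 x y
  refine ⟨A, φ, hφc, hφ2, fun μ _ g hgm hg1 hgl => ?_⟩
  have happrox : ∀ y, |g y - ∑ x ∈ A, g x * φ x y| ≤ 2 * ε + (1 - ∑ x ∈ A, φ x y) := fun y => by
    have e : g y - ∑ x ∈ A, g x * φ x y
        = ∑ x ∈ A, (g y - g x) * φ x y + g y * (1 - ∑ x ∈ A, φ x y) := by
      simp only [sub_mul, Finset.sum_sub_distrib, ← Finset.mul_sum]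
      ring
    have h1 : |∑ x ∈ A, (g y - g x) * φ x y| ≤ 2 * ε := by
      calc |∑ x ∈ A, (g y - g x) * φ x y| ≤ ∑ x ∈ A, |(g y - g x) * φ x y| :=
            Finset.abs_sum_le_sum_abs _ _
        _ ≤ ∑ x ∈ A, 2 * ε * φ x y := by
            refine Finset.sum_le_sum fun x hx => ?_
            rw [abs_mul, abs_of_nonneg (hφ0 x y)]
            rcases le_or_gt (dist y x) (2 * ε) with hd | hd
            · exact mul_le_mul_of_nonneg_right ((hgl y x).trans hd) (hφ0 x y)
            · have : φ x y = 0 := by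
                simp [φ, ψ, max_eq_right (sub_nonpos.2 hd.le)]
              simp [this]
        _ = 2 * ε * ∑ x ∈ A, φ x y := by rw [Finset.mul_sum]
        _ ≤ 2 * ε := mul_le_of_le_one_right (by positivity) (hsum1 y)
    have h2 : |g y * (1 - ∑ x ∈ A, φ x y)| ≤ 1 - ∑ x ∈ A, φ x y := by
      rw [abs_mul, abs_of_nonneg (sub_nonneg.2 (hsum1 y))]
      exact mul_le_of_le_one_left (sub_nonneg.2 (hsum1 y)) (hg1 y)
    rw [e]
    exact (abs_add_le _ _).trans (add_le_add h1 h2)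
  have hgint : ∀ (μ : Measure F) [IsProbabilityMeasure μ], Integrable g μ := fun μ _ =>
    Integrable.of_bound hgm.aestronglyMeasurable 1 (ae_of_all _ hg1)
  have b1 := abs_integral_sub_sum_mul_integral_le μ A (hint μ) (hgint μ) g happrox
  have b2 := abs_integral_sub_sum_mul_integral_le ρ A (hint ρ) (hgint ρ) g happrox
  have b3 : |∑ x ∈ A, ∫ y, φ x y ∂μ - ∑ x ∈ A, ∫ y, φ x y ∂ρ|
      ≤ ∑ x ∈ A, |∫ y, φ x y ∂μ - ∫ y, φ x y ∂ρ| := by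
    rw [← Finset.sum_sub_distrib]
    exact Finset.abs_sum_le_sum_abs _ _
  have b4 : |∑ x ∈ A, g x * ∫ y, φ x y ∂μ - ∑ x ∈ A, g x * ∫ y, φ x y ∂ρ|
      ≤ ∑ x ∈ A, |∫ y, φ x y ∂μ - ∫ y, φ x y ∂ρ| := by
    rw [← Finset.sum_sub_distrib]
    refine (Finset.abs_sum_le_sum_abs _ _).trans (Finset.sum_le_sum fun x _ => ?_)
    rw [← mul_sub, abs_mul]
    exact mul_le_of_le_one_left (abs_nonneg _) (hg1 x)
  rw [abs_le] at *
  constructor <;> linarith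

/-- If two-argument properties `G n` hold eventually near every point of `s × s`, then they hold
eventually near every point of `s`, uniformly on a finite union of balls that carries most of the
mass of an `s`-valued random variable. -/
lemma exists_ball_forall_biUnion_ball {E : Type*} [PseudoMetricSpace E] [MeasurableSpace E]
    (hball : ∀ (x : E) (r : ℝ), MeasurableSet (Metric.ball x r))
    {s : Set E} (hs : TopologicalSpace.IsSeparable s)
    {Ω : Type*} [MeasurableSpace Ω] (P : Measure Ω) [IsFiniteMeasure P]
    {ξ : Ω → E} (hξ : Measurable ξ) (hξs : ∀ ω, ξ ω ∈ s) {G : ℕ → E → E → Prop} {x : E}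
    (hG : ∀ x' ∈ s, ∀ᶠ q : (ℕ × E) × E in (atTop ×ˢ 𝓝 x) ×ˢ 𝓝 x', G q.1.1 q.1.2 q.2)
    {η : ℝ} (hη : 0 < η) :
    ∃ R > 0, ∃ (A : Finset E) (r : E → ℝ),
      P.real {ω | ξ ω ∉ ⋃ x' ∈ A, Metric.ball x' (r x')} < η ∧
      ∀ᶠ n in atTop, ∀ z ∈ Metric.ball x R, ∀ z' ∈ ⋃ x' ∈ A, Metric.ball x' (r x'), G n z z' := by
  have key : ∀ x' ∈ s, ∃ r > 0, ∀ᶠ p : ℕ × E in atTop ×ˢ 𝓝 x,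
      ∀ z' ∈ Metric.ball x' r, G p.1 p.2 z' := fun x' hx' => by
    obtain ⟨pa, hpa, pb, hpb, h⟩ := eventually_prod_iff.1 (hG x' hx')
    obtain ⟨r, hr, hrb⟩ := Metric.eventually_nhds_iff_ball.1 hpb
    exact ⟨r, hr, hpa.mono fun p hp z' hz' => h hp (hrb z' hz')⟩
  choose! r hr0 hr using key
  obtain ⟨A, hAs, hA⟩ :=
    exists_finset_measureReal_notMem_biUnion_ball_lt hball hs P hξ hξs hr0 hη
  obtain ⟨pa, hpa, pb, hpb, h⟩ := eventually_prod_iff.1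
    ((eventually_all_finset A).2 fun x' hx' => hr x' (hAs hx'))
  obtain ⟨R, hR, hRb⟩ := Metric.eventually_nhds_iff_ball.1 hpb
  refine ⟨R, hR, A, r, hA, hpa.mono fun n hn z hz z' hz' => ?_⟩
  simp only [Set.mem_iUnion] at hz'
  obtain ⟨x', hx', hz'⟩ := hz'
  exact h hn (hRb z hz) x' hx' z' hz'

lemma tendsto_measureReal_zero_of_ae_eventually_notMem {Ω : Type*} [MeasurableSpace Ω]
    (P : Measure Ω) [IsFiniteMeasure P] {S : ℕ → Set Ω} (hS : ∀ n, MeasurableSet (S n))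
    (h : ∀ᵐ ω ∂P, ∀ᶠ n in atTop, ω ∉ S n) :
    Tendsto (fun n => P.real (S n)) atTop (𝓝 0) := by
  have := tendsto_measure_of_ae_tendsto_indicator_of_isFiniteMeasure (μ := P) atTop
    MeasurableSet.empty hS (h.mono fun ω hω => hω.mono fun n hn => by simpa using hn)
  simpa [Measure.real, Function.comp_def] using (ENNReal.tendsto_toReal (measure_ne_top P ∅)).comp this

lemma dBL_le {G : Type*} [PseudoMetricSpace G] [MeasurableSpace G] {μ ν : Measure G} {C : ℝ}
    (h : ∀ g : G → ℝ, Measurable g → (∀ x, |g x| ≤ 1) → (∀ x y, |g x - g y| ≤ dist x y) →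
      |∫ x, g x ∂μ - ∫ x, g x ∂ν| ≤ C) :
    dBL μ ν ≤ C := by
  refine csSup_le ⟨_, fun _ => 0, ⟨measurable_const, by simp, by simp⟩, rfl⟩ ?_
  rintro _ ⟨g, ⟨hg, hg1, hgl⟩, rfl⟩
  exact h g hg hg1 hgl

lemma abs_integral_map_sub_integral_map_le {F : Type*} [PseudoMetricSpace F] [MeasurableSpace F]
    {Ω : Type*} [MeasurableSpace Ω] (P : Measure Ω) [IsProbabilityMeasure P] {X Y : Ω → F}
    (hX : Measurable X) (hY : Measurable Y) {B : Set Ω} (hB : MeasurableSet B) {ε : ℝ}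
    (hε : 0 ≤ ε) (hXY : ∀ ω ∉ B, dist (X ω) (Y ω) ≤ ε) {g : F → ℝ} (hg : Measurable g)
    (hg1 : ∀ x, |g x| ≤ 1) (hgl : ∀ x y, |g x - g y| ≤ dist x y) :
    |∫ x, g x ∂(P.map X) - ∫ x, g x ∂(P.map Y)| ≤ ε + 2 * P.real B := by
  have hint : ∀ {W : Ω → F}, Measurable W → Integrable (fun ω => g (W ω)) P := fun hW =>
    Integrable.of_bound (hg.comp hW).aestronglyMeasurable 1 (ae_of_all _ fun _ => hg1 _)
  have hBint : Integrable (B.indicator (1 : Ω → ℝ)) P := (integrable_const 1).indicator hB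
  rw [integral_map hX.aemeasurable hg.aestronglyMeasurable,
    integral_map hY.aemeasurable hg.aestronglyMeasurable, ← integral_sub (hint hX) (hint hY)]
  have e : ε + 2 * P.real B = ∫ ω, (ε + 2 * B.indicator 1 ω) ∂P := by
    rw [integral_add (integrable_const _) (hBint.const_mul 2), integral_const_mul,
      integral_indicator_one hB]
    simp
  rw [e]
  refine abs_integral_le_integral_abs.trans (integral_mono ((hint hX).sub (hint hY)).abs
    ((integrable_const _).add (hBint.const_mul 2)) fun ω => ?_)
  by_cases hω : ω ∈ B
  · have := abs_le.1 (hg1 (X ω))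
    have := abs_le.1 (hg1 (Y ω))
    simp only [Set.indicator_of_mem hω, Pi.one_apply, abs_le]
    constructor <;> linarith
  · simpa [Set.indicator_of_notMem hω] using (hgl _ _).trans (hXY ω hω)

/-- Along increments `z → x` and `z' → x'`, the rescaled differences
`a n • (f (θ + (z + z') / a n) - f (θ + z / a n))` of a quasi-Hadamard differentiable map approach
the derivative in the direction `z'`. -/
lemma eventually_norm_rescaled_sub_sub_lt
    {V : Type*} [AddCommGroup V] [Module ℝ V]
    {E : Type*} [NormedAddCommGroup E] [NormedSpace ℝ E] (ι : E →ₗ[ℝ] V)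
    {F : Type*} [NormedAddCommGroup F] [NormedSpace ℝ F]
    (E₀ : Submodule ℝ E) (Vf : Set V) (f : V → F) (θ : V)
    {a : ℕ → ℝ} (ha_pos : ∀ n, 0 < a n) (ha_top : Tendsto a atTop atTop)
    (L : E →L[ℝ] F)
    (hqH : ∀ x₀ ∈ E₀, ∀ xs : ℕ → E, ∀ εs : ℕ → ℝ,
      (∀ n, 0 < εs n) → Tendsto εs atTop (𝓝 0) →
      Tendsto (fun n => ‖xs n - x₀‖) atTop (𝓝 0) →
      (∀ n, θ + εs n • ι (xs n) ∈ Vf) →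
      Tendsto (fun n => ‖L x₀ - (εs n)⁻¹ • (f (θ + εs n • ι (xs n)) - f θ)‖) atTop (𝓝 0))
    {ε : ℝ} (hε : 0 < ε) {x x' : E} (hx : x ∈ E₀) (hx' : x' ∈ E₀) :
    ∀ᶠ q : (ℕ × E) × E in (atTop ×ˢ 𝓝 x) ×ˢ 𝓝 x',
      θ + (a q.1.1)⁻¹ • ι q.1.2 ∈ Vf → θ + (a q.1.1)⁻¹ • ι (q.1.2 + q.2) ∈ Vf →
      ‖a q.1.1 • (f (θ + (a q.1.1)⁻¹ • ι (q.1.2 + q.2)) - f (θ + (a q.1.1)⁻¹ • ι q.1.2))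
        - L q.2‖ < ε := by
  by_contra hcon
  obtain ⟨u, hu, hbad⟩ := exists_seq_forall_of_frequently (not_eventually.1 hcon)
  push Not at hbad
  have hn : Tendsto (fun k => (u k).1.1) atTop atTop := (hu.fst).fst
  have hz : Tendsto (fun k => (u k).1.2) atTop (𝓝 x) := (hu.fst).snd
  have hz' : Tendsto (fun k => (u k).2) atTop (𝓝 x') := hu.snd
  have hεs : Tendsto (fun k => (a (u k).1.1)⁻¹) atTop (𝓝 0) :=
    tendsto_inv_atTop_zero.comp (ha_top.comp hn)
  have hlim : ∀ (y : ℕ → E) (y₀ : E), y₀ ∈ E₀ → Tendsto y atTop (𝓝 y₀) →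
      (∀ k, θ + (a (u k).1.1)⁻¹ • ι (y k) ∈ Vf) →
      Tendsto (fun k => a (u k).1.1 • (f (θ + (a (u k).1.1)⁻¹ • ι (y k)) - f θ)) atTop
        (𝓝 (L y₀)) := fun y y₀ hy₀ hy hmem => by
    have := hqH y₀ hy₀ y _ (fun k => inv_pos.2 (ha_pos _)) hεs
      (tendsto_iff_norm_sub_tendsto_zero.1 hy) hmem
    simp only [inv_inv, norm_sub_rev (L y₀)] at this
    exact tendsto_iff_norm_sub_tendsto_zero.2 this
  have h1 := hlim _ _ hx hz fun k => (hbad k).1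
  have h2 := hlim _ _ (E₀.add_mem hx hx') (hz.add hz') fun k => (hbad k).2.1
  have h3 := ((h2.sub h1).sub ((L.continuous.tendsto x').comp hz')).norm
  simp only [map_add, add_sub_cancel_left, sub_self, norm_zero] at h3
  obtain ⟨k, hk⟩ := ((tendsto_order.1 h3).2 ε hε).exists
  refine (hbad k).2.2.not_gt (lt_of_eq_of_lt ?_ hk)
  congr 1
  simp only [Function.comp_apply, map_add, ← smul_sub, sub_sub_sub_cancel_right]

/-- **Delta-method for the bootstrap, almost-sure version** (Theorem 3.1(ii)).
The ambient vector space `V` contains the normed space `E` as a linear subspace; this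
is modelled by an injective linear map `ι : E →ₗ[ℝ] V`.  "`a_n(T̂_n − θ)` takes values
only in `E`" is expressed by exhibiting maps `Z n : Ω → E` (resp. `Zstar`, `Zstarθ`)
with `ι ∘ Z n = a_n(T̂_n − θ)` etc. -/
theorem bootstrap_delta_method_as
    {V : Type*} [AddCommGroup V] [Module ℝ V]
    {E : Type*} [NormedAddCommGroup E] [NormedSpace ℝ E]
    (ι : E →ₗ[ℝ] V) (hι : Function.Injective ι)
    {F : Type*} [NormedAddCommGroup F] [NormedSpace ℝ F]
    [TopologicalSpace.SeparableSpace F] [mF : MeasurableSpace F] [BorelSpace F]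
    [mE : MeasurableSpace E] (hmE : mE = ballSigma E)
    (E₀ : Submodule ℝ E) (hE₀sep : TopologicalSpace.IsSeparable (E₀ : Set E))
    (hE₀meas : MeasurableSet (E₀ : Set E))
    (Vf : Set V) (f : V → F) (θ : V) (hθ : θ ∈ Vf)
    (a : ℕ → ℝ) (ha_pos : ∀ n, 0 < a n) (ha_top : Tendsto a atTop atTop)
    {Ω Ω' : Type*} [MeasurableSpace Ω] [MeasurableSpace Ω']
    (P : Measure Ω) [IsProbabilityMeasure P] (P' : Measure Ω') [IsProbabilityMeasure P']
    (T : ℕ → Ω → V) (hT : ∀ n ω, T n ω ∈ Vf)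
    (Tstar : ℕ → Ω × Ω' → V) (hTstar : ∀ n p, Tstar n p ∈ Vf)
    -- (a) `a_n(T̂_n − θ)` takes values only in `E`, is measurable, and converges in
    -- distribution° to ξ, which takes values in E₀
    (Z : ℕ → Ω → E) (hZ : ∀ n ω, ι (Z n ω) = a n • (T n ω - θ))
    (hZmeas : ∀ n, Measurable (Z n))
    {Ω₀ : Type*} [MeasurableSpace Ω₀] (P₀ : Measure Ω₀) [IsProbabilityMeasure P₀]
    (ξ : Ω₀ → E) (hξmeas : Measurable ξ) (hξmem : ∀ ω₀, ξ ω₀ ∈ E₀)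
    (hconv : ∀ g : E → ℝ, Continuous g → (∃ C, ∀ y, |g y| ≤ C) → Measurable g →
      Tendsto (fun n => ∫ ω, g (Z n ω) ∂P) atTop (𝓝 (∫ ω₀, g (ξ ω₀) ∂P₀)))
    -- (b) `f(T̂_n)` is measurable
    (hfmeas : ∀ n, Measurable fun ω => f (T n ω))
    -- (c) `f` is quasi-Hadamard differentiable at `θ` tangentially to `E₀⟨E⟩` with
    -- derivative `f'` (a continuous map on `E₀`, modelled as a total map `E → F`)
    (f' : E → F) (hf'cont : ContinuousOn f' (E₀ : Set E))
    (hqH : ∀ x₀ ∈ E₀, ∀ xs : ℕ → E, ∀ εs : ℕ → ℝ,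
      (∀ n, 0 < εs n) → Tendsto εs atTop (𝓝 0) →
      Tendsto (fun n => ‖xs n - x₀‖) atTop (𝓝 0) →
      (∀ n, θ + εs n • ι (xs n) ∈ Vf) →
      Tendsto (fun n => ‖f' x₀ - (εs n)⁻¹ • (f (θ + εs n • ι (xs n)) - f θ)‖) atTop (𝓝 0))
    -- (d) the extension `f' : E → F` is linear, measurable, and continuous at points of E₀
    (hf'lin : IsLinearMap ℝ f') (hf'meas : Measurable f')
    (hf'contAt : ∀ y ∈ E₀, ContinuousAt f' y)
    -- (e) `f(T̂_n*)` is measurable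
    (hfstarmeas : ∀ n, Measurable fun p : Ω × Ω' => f (Tstar n p))
    -- (f) `a_n(T̂_n* − θ)` and `a_n(T̂_n* − T̂_n)` take values only in `E`, are measurable,
    -- and `(T̂_n*)` is almost surely a bootstrap version of `(T̂_n)`
    (Zstarθ : ℕ → Ω × Ω' → E) (hZstarθ : ∀ n p, ι (Zstarθ n p) = a n • (Tstar n p - θ))
    (hZstarθmeas : ∀ n, Measurable (Zstarθ n))
    (Zstar : ℕ → Ω × Ω' → E) (hZstar : ∀ n p, ι (Zstar n p) = a n • (Tstar n p - T n p.1))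
    (hZstarmeas : ∀ n, Measurable (Zstar n))
    (hboot : ∀ᵐ ω ∂P, ∀ g : E → ℝ, Continuous g → (∃ C, ∀ y, |g y| ≤ C) → Measurable g →
      Tendsto (fun n => ∫ ω', g (Zstar n (ω, ω')) ∂P') atTop (𝓝 (∫ ω₀, g (ξ ω₀) ∂P₀))) :
    -- conclusions
    (∀ n, Measurable fun p : Ω × Ω' => a n • (f (Tstar n p) - f (T n p.1))) ∧
    Measurable (fun ω₀ => f' (ξ ω₀)) ∧
    ∀ δ : ℝ, 0 < δ →
      Tendsto (fun n => P {ω |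
          δ ≤ dBL (Measure.map (fun ω' => a n • (f (Tstar n (ω, ω')) - f (T n ω))) P')
                (Measure.map (fun ω₀ => f' (ξ ω₀)) P₀)})
        atTop (𝓝 0) := by
  have hball := measurableSet_ball_of_eq_ballSigma hmE
  have : SecondCountableTopology F := UniformSpace.secondCountable_of_separable F
  have hW : ∀ n, Measurable fun p : Ω × Ω' => a n • (f (Tstar n p) - f (T n p.1)) := fun n =>
    ((hfstarmeas n).sub ((hfmeas n).comp measurable_fst)).const_smul (a n)
  have hfξ : Measurable fun ω₀ => f' (ξ ω₀) := hf'meas.comp hξmeas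
  refine ⟨hW, hfξ, fun δ hδ => ?_⟩
  obtain ⟨L, rfl⟩ : ∃ L : E →L[ℝ] F, f' = L := by
    have hc : ContinuousAt (hf'lin.mk' f') 0 := hf'contAt 0 E₀.zero_mem
    exact ⟨⟨hf'lin.mk' f', continuous_of_continuousAt_zero (hf'lin.mk' f') hc⟩, rfl⟩
  have hTZ : ∀ n ω, θ + (a n)⁻¹ • ι (Z n ω) = T n ω := fun n ω => by
    rw [hZ, inv_smul_smul₀ (ha_pos n).ne', add_sub_cancel]
  have hTZstar : ∀ n p, θ + (a n)⁻¹ • ι (Z n p.1 + Zstar n p) = Tstar n p := fun n p => by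
    rw [map_add, hZ, hZstar, ← smul_add, inv_smul_smul₀ (ha_pos n).ne']
    abel
  set ρ : Measure F := P₀.map fun ω₀ => L (ξ ω₀)
  have : IsProbabilityMeasure ρ := Measure.isProbabilityMeasure_map hfξ.aemeasurable
  obtain ⟨ε, hε, hεδ⟩ : ∃ ε > 0, 11 * ε < δ := ⟨δ / 12, by positivity, by linarith⟩
  obtain ⟨C, φ, hφc, hφ2, hφ⟩ := exists_finset_abs_integral_sub_le ρ hε
  let G : ℕ → E → E → Prop := fun n z z' =>
    θ + (a n)⁻¹ • ι z ∈ Vf → θ + (a n)⁻¹ • ι (z + z') ∈ Vf →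
      ‖a n • (f (θ + (a n)⁻¹ • ι (z + z')) - f (θ + (a n)⁻¹ • ι z)) - L z'‖ < ε
  have hloc : ∀ x ∈ (E₀ : Set E), _ := fun x hx =>
    exists_ball_forall_biUnion_ball hball hE₀sep P₀ hξmeas hξmem (x := x) (G := G)
      (fun x' hx' => eventually_norm_rescaled_sub_sub_lt ι E₀ Vf f θ ha_pos ha_top L hqH hε hx hx')
      hε
  choose! R hR A r hA hgood using hloc
  let U : E → Set E := fun x => ⋃ x' ∈ A x, Metric.ball x' (r x x')
  have hU : ∀ x, MeasurableSet (U x) := fun x => measurableSet_biUnion_ball hball (A x) (r x)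
  let S : E → ℕ → Set Ω := fun x n => {ω | ε ≤ P'.real {ω' | Zstar n (ω, ω') ∉ U x}}
  have hSm : ∀ x n, MeasurableSet (S x n) := fun x n =>
    measurableSet_le measurable_const
      (measurable_measure_prodMk_left (hZstarmeas n (hU x).compl)).ennreal_toReal
  have hS : ∀ x ∈ E₀, Tendsto (fun n => P.real (S x n)) atTop (𝓝 0) := fun x hx => by
    refine tendsto_measureReal_zero_of_ae_eventually_notMem P (hSm x) ?_
    filter_upwards [hboot] with ω hω
    filter_upwards [eventually_measureReal_notMem_biUnion_ball_lt hball P' P₀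
      (fun n => (hZstarmeas n).comp measurable_prodMk_left) hξmeas hω (A x) (r x) (hA x hx)]
      with n hn
    exact not_le.2 hn
  let D : ℕ → Set Ω := fun n =>
    {ω | ε ≤ ∑ y ∈ C, |∫ ω', φ y (L (Zstar n (ω, ω'))) ∂P' - ∫ ω₀, φ y (L (ξ ω₀)) ∂P₀|}
  have hDm : ∀ n, MeasurableSet (D n) := fun n => by
    refine measurableSet_le measurable_const (Finset.measurable_sum _ fun y _ => ?_)
    refine Measurable.abs (Measurable.sub_const ?_ _)
    exact ((hφc y).measurable.comp
      (hf'meas.comp (hZstarmeas n))).stronglyMeasurable.integral_prod_right'.measurable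
  have hD : Tendsto (fun n => P.real (D n)) atTop (𝓝 0) := by
    refine tendsto_measureReal_zero_of_ae_eventually_notMem P hDm ?_
    filter_upwards [hboot] with ω hω
    have hlim : Tendsto (fun n => ∑ y ∈ C, |∫ ω', φ y (L (Zstar n (ω, ω'))) ∂P'
        - ∫ ω₀, φ y (L (ξ ω₀)) ∂P₀|) atTop (𝓝 (∑ y ∈ C, 0)) := by
      refine tendsto_finsetSum _ fun y _ => ?_
      have := (hω (fun z => φ y (L z)) ((hφc y).comp L.continuous) ⟨2, fun z => hφ2 y _⟩
        ((hφc y).measurable.comp hf'meas)).sub_const (∫ ω₀, φ y (L (ξ ω₀)) ∂P₀)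
      simpa using this.abs
    rw [Finset.sum_const_zero] at hlim
    exact ((tendsto_order.1 hlim).2 ε hε).mono fun n hn => not_le.2 hn
  rw [← ENNReal.tendsto_toReal_iff (fun n => measure_ne_top _ _) ENNReal.zero_ne_top,
    ENNReal.toReal_zero]
  refine tendsto_order.2
    ⟨fun b hb => Eventually.of_forall fun n => hb.trans_le ENNReal.toReal_nonneg, fun κ hκ => ?_⟩
  obtain ⟨B, hBE, hB⟩ := exists_finset_measureReal_notMem_biUnion_ball_lt hball hE₀sep P₀ hξmeas
    hξmem hR (half_pos hκ)
  have hsmall : Tendsto (fun n => ∑ x ∈ B, P.real (S x n) + P.real (D n)) atTop (𝓝 0) := by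
    simpa using (tendsto_finsetSum B fun x hx => hS x (hBE hx)).add hD
  filter_upwards [eventually_measureReal_notMem_biUnion_ball_lt hball P P₀ hZmeas hξmeas hconv B R
    hB, (tendsto_order.1 hsmall).2 _ (half_pos hκ),
    (eventually_all_finset B).2 fun x hx => hgood x (hBE hx)] with n h1 h2 h3
  have hsub : {ω | δ ≤ dBL (P'.map fun ω' => a n • (f (Tstar n (ω, ω')) - f (T n ω))) ρ} ⊆
      {ω | Z n ω ∉ ⋃ x ∈ B, Metric.ball x (R x)} ∪ ((⋃ x ∈ B, S x n) ∪ D n) := by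
    intro ω hω
    by_contra hcon
    simp only [Set.mem_union, not_or, Set.mem_ofPred_eq, not_not] at hcon
    obtain ⟨hZω, hSω, hDω⟩ := hcon
    simp only [Set.mem_iUnion] at hZω
    obtain ⟨x, hx, hxω⟩ := hZω
    have hSx : P'.real {ω' | Zstar n (ω, ω') ∉ U x} < ε :=
      not_le.1 fun h => hSω (Set.mem_biUnion hx h)
    have hZω : Measurable fun ω' => Zstar n (ω, ω') :=
      (hZstarmeas n).comp measurable_prodMk_left
    have hWω : Measurable fun ω' => a n • (f (Tstar n (ω, ω')) - f (T n ω)) :=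
      (hW n).comp measurable_prodMk_left
    have hLω : Measurable fun ω' => L (Zstar n (ω, ω')) := hf'meas.comp hZω
    have : IsProbabilityMeasure (P'.map fun ω' => L (Zstar n (ω, ω'))) :=
      Measure.isProbabilityMeasure_map hLω.aemeasurable
    refine (lt_of_le_of_lt (dBL_le (C := 11 * ε) fun g hg hg1 hgl => ?_) hεδ).not_ge hω
    have e1 := abs_integral_map_sub_integral_map_le P' hWω hLω (hZω (hU x).compl) hε.le
      (fun ω' hω' => by
        have := h3 x hx _ hxω _ (not_not.1 hω')
        simp only [G, hTZ, hTZstar n (ω, ω')] at this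
        rw [dist_eq_norm]
        exact (this (hT n ω) (hTstar n _)).le) hg hg1 hgl
    have e2 := hφ (P'.map fun ω' => L (Zstar n (ω, ω'))) g hg hg1 hgl
    have e3 : ∀ y, ∫ z, φ y z ∂(P'.map fun ω' => L (Zstar n (ω, ω')))
        - ∫ z, φ y z ∂ρ
        = ∫ ω', φ y (L (Zstar n (ω, ω'))) ∂P' - ∫ ω₀, φ y (L (ξ ω₀)) ∂P₀ := fun y => by
      rw [integral_map hLω.aemeasurable (hφc y).measurable.aestronglyMeasurable,
        integral_map hfξ.aemeasurable (hφc y).measurable.aestronglyMeasurable]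
    simp only [e3] at e2
    have e4 : ∑ y ∈ C, |∫ ω', φ y (L (Zstar n (ω, ω'))) ∂P' - ∫ ω₀, φ y (L (ξ ω₀)) ∂P₀| < ε :=
      lt_of_not_ge fun h => hDω h
    have e5 : P'.real ((fun ω' => Zstar n (ω, ω')) ⁻¹' (U x)ᶜ) < ε := hSx
    refine (abs_sub_le _ (∫ z, g z ∂(P'.map fun ω' => L (Zstar n (ω, ω')))) _).trans ?_
    linarith
  calc P.real _ ≤ _ := measureReal_mono hsub
    _ ≤ P.real {ω | Z n ω ∉ ⋃ x ∈ B, Metric.ball x (R x)}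
        + (∑ x ∈ B, P.real (S x n) + P.real (D n)) := by
      refine (measureReal_union_le _ _).trans (add_le_add_right ?_ _)
      exact (measureReal_union_le _ _).trans
        (add_le_add_left (measureReal_biUnion_finset_le _ _) _)
    _ < κ := by linarith
end

section
/- Lemma 4.1: Let φ be a weight function and D_φ the corresponding weighted càdlàg space with norm ‖x‖_φ = sup_{t∈ℝ}|x(t)|φ(t). Then the trace 𝒟_φ on D_φ of the σ-algebra generated by the coordinate projections π_t : x ↦ x(t), t ∈ ℝ, coincides with the σ-algebra ℬ_φ° generated by the ‖·‖_φ-open balls {y ∈ D_φ : ‖x − y‖_φ < r}, x ∈ D_φ, r > 0. -/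
open MeasureTheory Filter Topology

/-- A weight function: a continuous function `φ : ℝ → [1,∞)` which is non-increasing on
`(−∞,0]` and non-decreasing on `[0,∞)`. -/
def IsWeightFun (φ : ℝ → ℝ) : Prop :=
  Continuous φ ∧ (∀ t, 1 ≤ φ t) ∧ AntitoneOn φ (Set.Iic 0) ∧ MonotoneOn φ (Set.Ici 0)

/-- Càdlàg: right-continuous with left limits. -/
def Cadlag (x : ℝ → ℝ) : Prop :=
  (∀ t, ContinuousWithinAt x (Set.Ici t) t) ∧
  ∀ t, ∃ L, Tendsto x (nhdsWithin t (Set.Iio t)) (𝓝 L)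

/-- The set `D_φ` of bounded càdlàg functions `x : ℝ → ℝ` with
`‖x‖_φ = sup_t |x(t)| φ(t) < ∞` and `lim_{|t|→∞} x(t) = 0`. -/
def DphiSet (φ : ℝ → ℝ) : Set (ℝ → ℝ) :=
  {x | Cadlag x ∧ (∃ C, ∀ t, |x t| ≤ C) ∧ (∃ C, ∀ t, |x t| * φ t ≤ C) ∧
    Tendsto x atTop (𝓝 0) ∧ Tendsto x atBot (𝓝 0)}

/-- The space `D_φ` as a subtype. -/
def Dphi (φ : ℝ → ℝ) := {x : ℝ → ℝ // x ∈ DphiSet φ}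

/-- The distance `‖x − y‖_φ = sup_t |x(t) − y(t)| φ(t)` on `D_φ`. -/
noncomputable def distPhi (φ : ℝ → ℝ) (x y : Dphi φ) : ℝ :=
  sSup (Set.range fun t => |x.1 t - y.1 t| * φ t)

/-- `𝒟_φ`: the trace on `D_φ` of the σ-algebra generated by the one-dimensional
coordinate projections `π_t : x ↦ x(t)`, `t ∈ ℝ` (the product σ-algebra on `ℝ → ℝ`). -/
def projSigmaPhi (φ : ℝ → ℝ) : MeasurableSpace (Dphi φ) :=
  MeasurableSpace.comap (fun x : Dphi φ => (x.1 : ℝ → ℝ)) MeasurableSpace.pi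

/-- `ℬ_φ°`: the σ-algebra on `D_φ` generated by the `‖·‖_φ`-open balls. -/
def ballSigmaPhi (φ : ℝ → ℝ) : MeasurableSpace (Dphi φ) :=
  MeasurableSpace.generateFrom
    {B : Set (Dphi φ) | ∃ (x : Dphi φ) (r : ℝ), 0 < r ∧ B = {y | distPhi φ x y < r}}

theorem bddAbove_range_distPhi {φ : ℝ → ℝ} (hφ : ∀ t, 0 ≤ φ t) (x y : Dphi φ) :
    BddAbove (Set.range fun t => |x.1 t - y.1 t| * φ t) := by
  obtain ⟨C, hC⟩ := x.2.2.2.1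
  obtain ⟨D, hD⟩ := y.2.2.2.1
  refine ⟨C + D, ?_⟩
  rintro _ ⟨t, rfl⟩
  have h := mul_le_mul_of_nonneg_right (abs_sub (x.1 t) (y.1 t)) (hφ t)
  have h₁ := hC t
  have h₂ := hD t
  dsimp only
  linarith

theorem le_distPhi {φ : ℝ → ℝ} (hφ : ∀ t, 0 ≤ φ t) (x y : Dphi φ) (t : ℝ) :
    |x.1 t - y.1 t| * φ t ≤ distPhi φ x y :=
  le_csSup (bddAbove_range_distPhi hφ x y) ⟨t, rfl⟩

theorem distPhi_le {φ : ℝ → ℝ} {x y : Dphi φ} {r : ℝ}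
    (h : ∀ t, |x.1 t - y.1 t| * φ t ≤ r) : distPhi φ x y ≤ r :=
  csSup_le (Set.range_nonempty _) (by rintro _ ⟨t, rfl⟩; exact h t)

theorem continuousWithinAt_weighted_sub {φ : ℝ → ℝ} (hφ : Continuous φ) (x y : Dphi φ) (t : ℝ) :
    ContinuousWithinAt (fun s => |x.1 s - y.1 s| * φ s) (Set.Ici t) t :=
  ((x.2.1.1 t).sub (y.2.1.1 t)).abs.mul hφ.continuousWithinAt

theorem le_of_forall_rat_le {f : ℝ → ℝ} (hf : ∀ t, ContinuousWithinAt f (Set.Ici t) t) {r : ℝ}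
    (h : ∀ q : ℚ, f q ≤ r) (t : ℝ) : f t ≤ r := by
  by_contra! hlt
  have hev : ∀ᶠ s in 𝓝[≥] t, r < f s := (hf t).eventually (eventually_gt_nhds hlt)
  obtain ⟨u, hu, hsub⟩ := mem_nhdsGE_iff_exists_Ico_subset.1 hev
  obtain ⟨q, hq₁, hq₂⟩ := exists_rat_btwn (show t < u from hu)
  exact absurd (h q) (not_le.2 (hsub ⟨hq₁.le, hq₂⟩))

theorem measurable_eval_projSigmaPhi (φ : ℝ → ℝ) (t : ℝ) :
    Measurable[projSigmaPhi φ] fun x : Dphi φ => x.1 t :=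
  (measurable_pi_apply t).comp (comap_measurable _)

theorem measurable_distPhi {φ : ℝ → ℝ} (hφ : IsWeightFun φ) (x : Dphi φ) :
    Measurable[projSigmaPhi φ] (distPhi φ x) := by
  let _ : MeasurableSpace (Dphi φ) := projSigmaPhi φ
  have hnonneg : ∀ t, 0 ≤ φ t := fun t => zero_le_one.trans (hφ.2.1 t)
  refine measurable_of_Iic fun r => ?_
  have heq : distPhi φ x ⁻¹' Set.Iic r = ⋂ q : ℚ, {y | |x.1 q - y.1 q| * φ q ≤ r} := by
    ext y
    simp only [Set.mem_preimage, Set.mem_Iic, Set.mem_iInter, Set.mem_ofPred_eq]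
    exact ⟨fun h q => (le_distPhi hnonneg x y q).trans h, fun h =>
      distPhi_le (le_of_forall_rat_le (continuousWithinAt_weighted_sub hφ.1 x y) h)⟩
  rw [heq]
  refine MeasurableSet.iInter fun q => measurableSet_le ?_ measurable_const
  exact ((measurable_const.sub (measurable_eval_projSigmaPhi φ q)).abs).mul_const _

theorem cadlag_indicator_Ico (c a b : ℝ) :
    Cadlag ((Set.Ico a b).indicator fun _ => c) := by
  constructor
  · intro t
    by_cases hat : a ≤ t
    · by_cases htb : t < b
      · refine (continuousWithinAt_const (b := c)).congr_of_eventuallyEq ?_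
          (Set.indicator_of_mem (Set.mem_Ico.2 ⟨hat, htb⟩) _)
        filter_upwards [Ico_mem_nhdsGE htb] with s hs
        exact Set.indicator_of_mem (Set.mem_Ico.2 ⟨hat.trans hs.1, hs.2⟩) _
      · refine (continuousWithinAt_const (b := 0)).congr_of_eventuallyEq ?_
          (Set.indicator_of_notMem (fun h => htb h.2) _)
        filter_upwards [self_mem_nhdsWithin] with s hs
        exact Set.indicator_of_notMem (fun h => htb (lt_of_le_of_lt hs h.2)) _
    · refine (continuousWithinAt_const (b := 0)).congr_of_eventuallyEq ?_
        (Set.indicator_of_notMem (fun h => hat h.1) _)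
      filter_upwards [Ico_mem_nhdsGE (not_le.1 hat)] with s hs
      exact Set.indicator_of_notMem (fun h => absurd h.1 (not_le.2 hs.2)) _
  · intro t
    by_cases hat : a < t
    · by_cases htb : t ≤ b
      · refine ⟨c, tendsto_const_nhds.congr' ?_⟩
        filter_upwards [Ico_mem_nhdsLT hat] with s hs
        exact (Set.indicator_of_mem (Set.mem_Ico.2 ⟨hs.1, hs.2.trans_le htb⟩) fun _ => c).symm
      · refine ⟨0, tendsto_const_nhds.congr' ?_⟩
        filter_upwards [Ico_mem_nhdsLT (not_le.1 htb)] with s hs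
        exact (Set.indicator_of_notMem (fun h => absurd h.2 (not_lt.2 hs.1)) _).symm
    · refine ⟨0, tendsto_const_nhds.congr' ?_⟩
      filter_upwards [self_mem_nhdsWithin] with s hs
      exact (Set.indicator_of_notMem (fun h => hat (lt_of_le_of_lt h.1 hs)) _).symm

theorem indicator_Ico_mem_DphiSet {φ : ℝ → ℝ} (hφ : IsWeightFun φ) (c a b : ℝ) :
    (Set.Ico a b).indicator (fun _ => c) ∈ DphiSet φ := by
  refine ⟨cadlag_indicator_Ico c a b, ⟨|c|, fun t => ?_⟩, ?_, ?_, ?_⟩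
  · by_cases h : t ∈ Set.Ico a b <;> simp [h]
  · obtain ⟨C, hC⟩ := isCompact_Icc.exists_bound_of_continuousOn (s := Set.Icc a b)
      hφ.1.continuousOn
    refine ⟨|c| * |C|, fun t => ?_⟩
    by_cases h : t ∈ Set.Ico a b
    · rw [Set.indicator_of_mem h]
      have h' := hC t ⟨h.1, h.2.le⟩
      gcongr
      exact (le_abs_self _).trans (h'.trans (le_abs_self _))
    · rw [Set.indicator_of_notMem h]
      simp only [abs_zero, zero_mul]
      positivity
  · refine tendsto_const_nhds.congr' ?_
    filter_upwards [eventually_ge_atTop b] with s hs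
    exact (Set.indicator_of_notMem (fun h => absurd h.2 (not_lt.2 hs)) _).symm
  · refine tendsto_const_nhds.congr' ?_
    filter_upwards [eventually_lt_atBot a] with s hs
    exact (Set.indicator_of_notMem (fun h => absurd h.1 (not_le.2 hs)) _).symm

/-- The step function `c · 1_[a,b)` as an element of `D_φ`. -/
noncomputable def stepDphi {φ : ℝ → ℝ} (hφ : IsWeightFun φ) (c a b : ℝ) : Dphi φ :=
  ⟨(Set.Ico a b).indicator fun _ => c, indicator_Ico_mem_DphiSet hφ c a b⟩

theorem setOf_lt_eval_eq_iUnion_ball {φ : ℝ → ℝ} (hφ : IsWeightFun φ) (t a : ℝ) :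
    {y : Dphi φ | a < y.1 t} = ⋃ n : ℕ, ⋃ m : ℕ,
      {y | distPhi φ (stepDphi hφ (a + (n + 1) / φ t) t (t + 1 / (m + 1))) y < n + 1} := by
  have hpos : ∀ s, 0 < φ s := fun s => zero_lt_one.trans_le (hφ.2.1 s)
  have hnonneg : ∀ s, 0 ≤ φ s := fun s => (hpos s).le
  ext y
  simp only [Set.mem_ofPred_eq, Set.mem_iUnion]
  constructor
  · intro hy
    obtain ⟨C, hC⟩ := y.2.2.2.1
    obtain ⟨n, hn⟩ := exists_nat_gt (max C ((y.1 t - a) * φ t))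
    have hnC : C < n := (le_max_left _ _).trans_lt hn
    have hny : (y.1 t - a) * φ t < n := (le_max_right _ _).trans_lt hn
    have hn0 : (0 : ℝ) ≤ n := n.cast_nonneg
    set c : ℝ := a + (n + 1) / φ t with hc
    have hct : (c - y.1 t) * φ t = (n + 1) - (y.1 t - a) * φ t := by
      rw [hc]
      field_simp [(hpos t).ne']
      ring
    have hya : 0 < (y.1 t - a) * φ t := mul_pos (sub_pos.2 hy) (hpos t)
    have ht : |c - y.1 t| * φ t < n + 1 := by
      rw [← abs_of_pos (hpos t), ← abs_mul, hct, abs_lt]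
      constructor <;> linarith
    obtain ⟨r, hr₁, hr₂⟩ := exists_between ht
    have hcont : ContinuousWithinAt (fun s => |c - y.1 s| * φ s) (Set.Ici t) t :=
      (continuousWithinAt_const.sub (y.2.1.1 t)).abs.mul hφ.1.continuousWithinAt
    obtain ⟨u, hu, hsub⟩ :=
      mem_nhdsGE_iff_exists_Ico_subset.1 (hcont.eventually (eventually_lt_nhds hr₁))
    obtain ⟨m, hm⟩ := exists_nat_one_div_lt (sub_pos.2 (show t < u from hu))
    refine ⟨n, m, lt_of_le_of_lt (distPhi_le (r := max r C) fun s => ?_)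
      (max_lt hr₂ (by linarith))⟩
    by_cases hs : s ∈ Set.Ico t (t + 1 / ((m : ℝ) + 1))
    · have hstep : (stepDphi hφ c t (t + 1 / (m + 1))).1 s = c := Set.indicator_of_mem hs fun _ => c
      rw [hstep]
      exact (le_of_lt (hsub ⟨hs.1, by linarith [hs.2]⟩)).trans (le_max_left _ _)
    · have hstep : (stepDphi hφ c t (t + 1 / (m + 1))).1 s = 0 := Set.indicator_of_notMem hs fun _ => c
      rw [hstep, zero_sub, abs_neg]
      exact (hC s).trans (le_max_right _ _)
  · rintro ⟨n, m, h⟩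
    have ht := (le_distPhi hnonneg _ y t).trans_lt h
    have hmem : t ∈ Set.Ico t (t + 1 / ((m : ℝ) + 1)) :=
      ⟨le_rfl, lt_add_of_pos_right _ Nat.one_div_pos_of_nat⟩
    have hstep : (stepDphi hφ (a + (n + 1) / φ t) t (t + 1 / (m + 1))).1 t
        = a + (n + 1) / φ t := Set.indicator_of_mem hmem fun _ => _
    rw [hstep, ← lt_div_iff₀ (hpos t)] at ht
    linarith [(abs_lt.1 ht).2]

theorem measurable_eval_ballSigmaPhi {φ : ℝ → ℝ} (hφ : IsWeightFun φ) (t : ℝ) :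
    Measurable[ballSigmaPhi φ] fun x : Dphi φ => x.1 t := by
  let _ : MeasurableSpace (Dphi φ) := ballSigmaPhi φ
  refine measurable_of_Ioi fun a => ?_
  change MeasurableSet {y : Dphi φ | a < y.1 t}
  rw [setOf_lt_eval_eq_iUnion_ball hφ]
  exact .iUnion fun n => .iUnion fun m =>
    MeasurableSpace.measurableSet_generateFrom ⟨_, _, by positivity, rfl⟩

/-- **Lemma 4.1**: `𝒟_φ = ℬ_φ°`. -/
theorem projSigma_eq_ballSigma (φ : ℝ → ℝ) (hφ : IsWeightFun φ) :
    projSigmaPhi φ = ballSigmaPhi φ := by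
  apply le_antisymm
  · refine Measurable.comap_le ?_
    let _ : MeasurableSpace (Dphi φ) := ballSigmaPhi φ
    exact measurable_pi_lambda _ (measurable_eval_ballSigmaPhi hφ)
  · refine MeasurableSpace.generateFrom_le ?_
    rintro _ ⟨x, r, -, rfl⟩
    exact measurable_distPhi hφ x measurableSet_Iio
end

section
/- Lemma 5.1 (measurability of the weighted bootstrap empirical process): Let φ be a weight function, (Ω,ℱ,ℙ) and (Ω',ℱ',ℙ') probability spaces, X₁,…,X_n real-valued random variables on (Ω,ℱ,ℙ), and W_{n1},…,W_{nn} nonnegative real-valued random variables on (Ω',ℱ',ℙ') with ∑_{i=1}^n W_{ni} = n (a property satisfied by the bootstrap weights considered, e.g. Efron's and the Bayesian bootstrap). Define F̂_n(ω,t) := n⁻¹∑_{i=1}^n 1_{[X_i(ω),∞)}(t) and F̂_n*((ω,ω'),t) := n⁻¹∑_{i=1}^n W_{ni}(ω') 1_{[X_i(ω),∞)}(t). Then for every a_n > 0 the map (ω,ω') ↦ a_n(F̂_n*(ω,ω') − F̂_n(ω)) takes values only in D_φ and is measurable from (Ω×Ω', ℱ⊗ℱ') to (D_φ, 𝒟_φ).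 -/
open MeasureTheory Filter Topology

/-- The unit step `1_{[a,∞)}` is càdlàg. -/
theorem cadlag_step (a : ℝ) : Cadlag (fun t => if a ≤ t then (1 : ℝ) else 0) := by
  refine ⟨fun t => ?_, fun t => ?_⟩
  · rcases le_or_gt a t with h | h
    · refine (continuousWithinAt_const (b := (1 : ℝ))).congr (fun s hs => ?_) (if_pos h)
      exact if_pos (h.trans hs)
    · refine (continuousAt_const.congr (f := fun _ => (0 : ℝ)) ?_).continuousWithinAt
      filter_upwards [Iio_mem_nhds h] with s hs
      exact (if_neg (not_le.2 hs)).symm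
  · rcases lt_or_ge a t with h | h
    · refine ⟨1, tendsto_const_nhds.congr' ?_⟩
      filter_upwards [mem_nhdsWithin_of_mem_nhds (Ioi_mem_nhds h)] with s hs
      exact (if_pos (le_of_lt hs)).symm
    · refine ⟨0, tendsto_const_nhds.congr' ?_⟩
      filter_upwards [self_mem_nhdsWithin] with s hs
      exact (if_neg (not_le.2 (lt_of_lt_of_le hs h))).symm

/-- A finite linear combination of càdlàg functions is càdlàg. -/
theorem Cadlag.sum_mul {ι : Type*} (s : Finset ι) (c : ι → ℝ) {f : ι → ℝ → ℝ}
    (hf : ∀ i, Cadlag (f i)) : Cadlag (fun t => ∑ i ∈ s, c i * f i t) := by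
  refine ⟨fun t => ?_, fun t => ?_⟩
  · exact tendsto_finsetSum s fun i _ => ((hf i).1 t).const_mul (c i)
  · choose L hL using fun i => (hf i).2 t
    exact ⟨_, tendsto_finsetSum s fun i _ => (hL i).const_mul (c i)⟩

/-- A càdlàg function vanishing outside `[-M, M]` which is bounded lies in `D_φ`. -/
theorem mem_DphiSet_of_eq_zero {φ : ℝ → ℝ} (hφ : IsWeightFun φ) {x : ℝ → ℝ} (hx : Cadlag x)
    {B M : ℝ} (hB : ∀ t, |x t| ≤ B) (hM : ∀ t, M < |t| → x t = 0) : x ∈ DphiSet φ := by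
  refine ⟨hx, ⟨B, hB⟩, ?_, ?_, ?_⟩
  · obtain ⟨K, hK⟩ := (isCompact_Icc (a := -M) (b := M)).bddAbove_image hφ.1.continuousOn
    have hB0 : 0 ≤ B := (abs_nonneg _).trans (hB 0)
    refine ⟨B * max K 0, fun t => ?_⟩
    rcases lt_or_ge M |t| with h | h
    · rw [hM t h, abs_zero, zero_mul]
      positivity
    · have hK' : φ t ≤ max K 0 := le_max_of_le_left (hK ⟨t, abs_le.1 h, rfl⟩)
      exact mul_le_mul (hB t) hK' (zero_le_one.trans (hφ.2.1 t)) hB0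
  · refine tendsto_const_nhds.congr' ?_
    filter_upwards [eventually_gt_atTop M] with t ht
    exact (hM t (ht.trans_le (le_abs_self t))).symm
  · refine tendsto_const_nhds.congr' ?_
    filter_upwards [eventually_lt_atBot (-M)] with t ht
    exact (hM t (lt_of_lt_of_le (by linarith) (neg_le_abs t))).symm

/-- A finite combination of unit steps whose coefficients sum to zero lies in `D_φ`. -/
theorem sum_step_mem_DphiSet {φ : ℝ → ℝ} (hφ : IsWeightFun φ) {ι : Type*} (s : Finset ι)
    (c a : ι → ℝ) (hc : ∑ i ∈ s, c i = 0) :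
    (fun t => ∑ i ∈ s, c i * (if a i ≤ t then (1 : ℝ) else 0)) ∈ DphiSet φ := by
  refine mem_DphiSet_of_eq_zero hφ (Cadlag.sum_mul s c fun i => cadlag_step (a i))
    (B := ∑ i ∈ s, |c i|) (M := ∑ i ∈ s, |a i|) (fun t => ?_) (fun t ht => ?_)
  · refine (Finset.abs_sum_le_sum_abs _ _).trans (Finset.sum_le_sum fun i _ => ?_)
    split_ifs <;> simp
  · have ha : ∀ i ∈ s, |a i| < |t| := fun i hi =>
      (Finset.single_le_sum (f := fun i => |a i|) (fun _ _ => abs_nonneg _) hi).trans_lt ht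
    rcases le_total 0 t with h0 | h0
    · rw [← hc]
      refine Finset.sum_congr rfl fun i hi => ?_
      have := ha i hi
      rw [abs_of_nonneg h0] at this
      rw [if_pos ((le_abs_self _).trans this.le), mul_one]
    · refine Finset.sum_eq_zero fun i hi => ?_
      have := ha i hi
      rw [abs_of_nonpos h0] at this
      rw [if_neg (by linarith [neg_abs_le (a i)]), mul_zero]

/-- **Lemma 5.1**: the weighted bootstrap empirical process
`a_n (F̂_n* − F̂_n)` takes values only in `D_φ` and is `(ℱ ⊗ ℱ', 𝒟_φ)`-measurable.
Here the bootstrap weights `W_{n1},…,W_{nn}` are nonnegative with `∑ᵢ W_{ni} = n`. -/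
theorem bootstrap_empirical_process_measurable
    (φ : ℝ → ℝ) (hφ : IsWeightFun φ)
    {Ω Ω' : Type*} [MeasurableSpace Ω] [MeasurableSpace Ω']
    (P : Measure Ω) [IsProbabilityMeasure P] (P' : Measure Ω') [IsProbabilityMeasure P']
    (n : ℕ) (X : ℕ → Ω → ℝ) (hX : ∀ i, Measurable (X i))
    (W : ℕ → Ω' → ℝ) (hWmeas : ∀ i, Measurable (W i)) (hWpos : ∀ i ω', 0 ≤ W i ω')
    (hWsum : ∀ ω', ∑ i ∈ Finset.range n, W i ω' = (n : ℝ))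
    (an : ℝ) (han : 0 < an) :
    ∃ hmem : ∀ p : Ω × Ω',
        (fun t => an * ((n:ℝ)⁻¹ * ∑ i ∈ Finset.range n,
              W i p.2 * (if X i p.1 ≤ t then (1:ℝ) else 0)
            - (n:ℝ)⁻¹ * ∑ i ∈ Finset.range n, (if X i p.1 ≤ t then (1:ℝ) else 0)))
          ∈ DphiSet φ,
      @Measurable (Ω × Ω') (Dphi φ) inferInstance (projSigmaPhi φ)
        (fun p => (⟨fun t => an * ((n:ℝ)⁻¹ * ∑ i ∈ Finset.range n,
              W i p.2 * (if X i p.1 ≤ t then (1:ℝ) else 0)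
            - (n:ℝ)⁻¹ * ∑ i ∈ Finset.range n, (if X i p.1 ≤ t then (1:ℝ) else 0)),
          hmem p⟩ : Dphi φ)) := by
  refine ⟨fun p => ?_, ?_⟩
  · have hc : ∑ i ∈ Finset.range n, an * (n : ℝ)⁻¹ * (W i p.2 - 1) = 0 := by
      rw [← Finset.mul_sum, Finset.sum_sub_distrib, hWsum]
      simp
    convert sum_step_mem_DphiSet hφ (Finset.range n) _ (fun i => X i p.1) hc using 2 with t
    rw [← mul_sub, ← Finset.sum_sub_distrib, ← mul_assoc, Finset.mul_sum]
    exact Finset.sum_congr rfl fun i _ => by ring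
  · refine measurable_comap_iff.2 (measurable_pi_lambda _ fun t => ?_)
    have hstep : ∀ i, Measurable fun p : Ω × Ω' => if X i p.1 ≤ t then (1 : ℝ) else 0 := fun i =>
      Measurable.ite (measurableSet_le ((hX i).comp measurable_fst) measurable_const)
        measurable_const measurable_const
    have hW : ∀ i, Measurable fun p : Ω × Ω' => W i p.2 := fun i =>
      (hWmeas i).comp measurable_snd
    exact (((Finset.measurable_fun_sum _ fun i _ => (hW i).mul (hstep i)).const_mul _).sub
      ((Finset.measurable_fun_sum _ fun i _ => hstep i).const_mul _)).const_mul _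
end

section
/- VC-subgraph property of the weighted indicator class (step 1 in the proof of Theorem 5.4): Let φ : ℝ → [1,∞) be any function and define, for x ∈ ℝ, f_x : ℝ → ℝ by f_x := φ(x)·1_{(−∞,x]} if x ≤ 0 and f_x := −φ(x)·1_{(x,∞)} if x > 0. Then no three points of ℝ² are shattered by the subgraphs of this class: for every (x₁,t₁),(x₂,t₂),(x₃,t₃) ∈ ℝ² there exists a subset S ⊆ {1,2,3} such that there is no x ∈ ℝ with S = {i ∈ {1,2,3} : t_i < f_x(x_i)}. Consequently the class {f_x : x ∈ ℝ} is a VC-subgraph class with VC index at most 3. -/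
/-- The weighted indicator functions: `f_x = φ(x)·1_{(−∞,x]}` for `x ≤ 0` and
`f_x = −φ(x)·1_{(x,∞)}` for `x > 0`. -/
noncomputable def weightedInd (φ : ℝ → ℝ) (x : ℝ) (u : ℝ) : ℝ :=
  if x ≤ 0 then (if u ≤ x then φ x else 0) else (if x < u then -φ x else 0)

theorem lt_weightedInd_iff_of_nonneg {φ : ℝ → ℝ} (hφ : ∀ x, 1 ≤ φ x) {t : ℝ} (ht : 0 ≤ t)
    (x u : ℝ) : t < weightedInd φ x u ↔ x ≤ 0 ∧ u ≤ x ∧ t < φ x := by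
  have := hφ x
  unfold weightedInd
  split_ifs <;> constructor <;> intro h <;> grind

theorem lt_weightedInd_iff_of_neg {φ : ℝ → ℝ} (hφ : ∀ x, 1 ≤ φ x) {t : ℝ} (ht : t < 0)
    (x u : ℝ) : t < weightedInd φ x u ↔ x ≤ 0 ∨ u ≤ x ∨ t < -φ x := by
  have := hφ x
  unfold weightedInd
  split_ifs <;> constructor <;> intro h <;> grind

theorem exists_distinct_le_of_fin_three (u : Fin 3 → ℝ) :
    ∃ i j k : Fin 3, i ≠ j ∧ i ≠ k ∧ j ≠ k ∧ u i ≤ u k ∧ u j ≤ u k := by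
  obtain ⟨k, hk⟩ := Finite.exists_max u
  have h : ∀ k : Fin 3, ∃ i j : Fin 3, i ≠ j ∧ i ≠ k ∧ j ≠ k := by decide
  obtain ⟨i, j, hij, hik, hjk⟩ := h k
  exact ⟨i, j, k, hij, hik, hjk, hk i, hk j⟩

/-- **VC-subgraph property of the weighted indicator class** (step 1 in the proof of
Theorem 5.4): no three points of `ℝ²` are shattered by the subgraphs
`{(u,t) : t < f_x(u)}`, `x ∈ ℝ`; hence the class `{f_x : x ∈ ℝ}` is a VC-subgraph
class with VC index at most 3. -/
theorem weightedInd_not_shatter_three (φ : ℝ → ℝ) (hφ : ∀ x, 1 ≤ φ x)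
    (pt : Fin 3 → ℝ × ℝ) :
    ∃ S : Finset (Fin 3),
      ¬ ∃ x : ℝ, ∀ i : Fin 3, i ∈ S ↔ (pt i).2 < weightedInd φ x (pt i).1 := by
  by_contra! H
  by_cases hpos : ∀ i, 0 ≤ (pt i).2
  · obtain ⟨i, j, k, hij, hik, hjk, hi, hj⟩ :=
      exists_distinct_le_of_fin_three fun i => (pt i).1
    simp only [fun x i => lt_weightedInd_iff_of_nonneg hφ (hpos i) x (pt i).1] at H
    obtain ⟨x, hx⟩ := H {i, k}
    obtain ⟨y, hy⟩ := H {j, k}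
    have hxi := (hx i).1 (by simp)
    have hxk := (hx k).1 (by simp)
    have hxj := mt (hx j).2 (by simp [hij.symm, hjk])
    have hyj := (hy j).1 (by simp)
    have hyk := (hy k).1 (by simp)
    have hyi := mt (hy i).2 (by simp [hij, hik])
    grind
  by_cases hneg : ∀ i, (pt i).2 < 0
  · obtain ⟨i, j, k, hij, hik, hjk, hi, hj⟩ :=
      exists_distinct_le_of_fin_three fun i => -(pt i).1
    simp only [fun x i => lt_weightedInd_iff_of_neg hφ (hneg i) x (pt i).1] at H
    obtain ⟨x, hx⟩ := H {i}
    obtain ⟨y, hy⟩ := H {j}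
    have hxi := (hx i).1 (by simp)
    have hxk := mt (hx k).2 (by simp [hik.symm])
    have hxj := mt (hx j).2 (by simp [hij.symm])
    have hyj := (hy j).1 (by simp)
    have hyk := mt (hy k).2 (by simp [hjk.symm])
    have hyi := mt (hy i).2 (by simp [hij])
    grind
  push Not at hpos hneg
  obtain ⟨j, hj⟩ := hpos
  obtain ⟨i, hi⟩ := hneg
  have hij : j ≠ i := by
    rintro rfl
    exact absurd hj hi.not_gt
  obtain ⟨x, hx⟩ := H {i}
  have hxi := (lt_weightedInd_iff_of_nonneg hφ hi x _).1 ((hx i).1 (by simp))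
  have hxj := (hx j).2 ((lt_weightedInd_iff_of_neg hφ hj x _).2 (Or.inl hxi.1))
  exact hij (by simpa using hxj)
end

section
/- Square-integrable envelope bound (step 2 in the proof of Theorem 5.2): Let φ be a weight function and F : ℝ → [0,1] the distribution function of a Borel probability measure on ℝ (non-decreasing, right-continuous, with limits 0 at −∞ and 1 at +∞) satisfying ∫φ² dF < ∞. Then M₁ := sup_{t ≤ 0} F(t)²φ(t)² < ∞ and M₂ := sup_{t > 0} (1−F(t))²φ(t)² < ∞; moreover, for every t ≤ 0 and every x ∈ ℝ, (1_{(−∞,x]}(t) − F(x))²φ(x)² ≤ max{M₁, (1−F(t))²φ(t)², M₂}, for every t > 0 and every x ∈ ℝ, (1_{(−∞,x]}(t) − F(x))²φ(x)² ≤ max{M₁, F(t)²φ(t)², M₂}, and consequently the envelope function f̄(t) := sup_{x∈ℝ} (1_{(−∞,x]}(t) − F(x))φ(x) is Borel measurable with ∫ f̄(t)² dF(t) < ∞. -/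
open MeasureTheory Filter Topology

/-- The part of `φ²` carried by a set on which `φ ≥ c` dominates `μ s * c²`. -/
theorem measureReal_mul_sq_le_integral {φ : ℝ → ℝ} {μ : Measure ℝ} [IsProbabilityMeasure μ]
    (hφ2 : Integrable (fun t => (φ t) ^ 2) μ) {s : Set ℝ} (hs : MeasurableSet s) {c : ℝ}
    (hc : 0 ≤ c) (h : ∀ x ∈ s, c ≤ φ x) : μ.real s * c ^ 2 ≤ ∫ x, (φ x) ^ 2 ∂μ :=
  calc μ.real s * c ^ 2 = ∫ _ in s, c ^ 2 ∂μ := by simp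
    _ ≤ ∫ x in s, (φ x) ^ 2 ∂μ :=
        setIntegral_mono_on (integrable_const _) hφ2.integrableOn hs
          fun x hx => pow_le_pow_left₀ hc (h x hx) 2
    _ ≤ ∫ x, (φ x) ^ 2 ∂μ :=
        setIntegral_le_integral hφ2 (Eventually.of_forall fun x => sq_nonneg (φ x))

/-- A supremum over `x` of a function that switches from `b` to `a` at `x = t` is measurable
in `t`. -/
theorem measurable_sSup_range_ite {a b : ℝ → ℝ} (ha : ∀ t, BddAbove (a '' Set.Ici t))
    (hb : BddAbove (Set.range b)) :
    Measurable fun t => sSup (Set.range fun x => if t ≤ x then a x else b x) := by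
  have hb' (t : ℝ) : BddAbove (b '' Set.Iio t) := hb.mono (Set.image_subset_range _ _)
  have hA : Antitone fun t => sSup (a '' Set.Ici t) := fun s t hst =>
    csSup_le_csSup (ha s) (Set.nonempty_Ici.image _) (Set.image_mono (Set.Ici_subset_Ici.2 hst))
  have hB : Monotone fun t => sSup (b '' Set.Iio t) := fun s t hst =>
    csSup_le_csSup (hb' t) (Set.nonempty_Iio.image _) (Set.image_mono (Set.Iio_subset_Iio hst))
  convert hA.measurable.max hB.measurable using 2 with t
  rw [← csSup_union (ha t) (Set.nonempty_Ici.image _) (hb' t) (Set.nonempty_Iio.image _)]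
  congr 1
  ext y
  simp only [Set.mem_range, Set.mem_union, Set.mem_image, Set.mem_Ici, Set.mem_Iio]
  constructor
  · rintro ⟨x, rfl⟩
    rcases le_or_gt t x with h | h
    · exact Or.inl ⟨x, h, by simp [h]⟩
    · exact Or.inr ⟨x, h, by simp [h.not_ge]⟩
  · rintro (⟨x, h, rfl⟩ | ⟨x, h, rfl⟩)
    · exact ⟨x, by simp [h]⟩
    · exact ⟨x, by simp [h.not_ge]⟩

/-- **Square-integrable envelope bound** (step 2 in the proof of Theorem 5.2).
`μ` is the Borel probability measure on `ℝ` with distribution function `F`;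
`1_{(−∞,x]}(t)` is written `if t ≤ x then 1 else 0`, and
`f̄(t) = sup_x (1_{(−∞,x]}(t) − F(x)) φ(x)` is the envelope function. -/
theorem envelope_square_integrable
    (φ : ℝ → ℝ) (hφ : IsWeightFun φ)
    (μ : Measure ℝ) [IsProbabilityMeasure μ]
    (F : ℝ → ℝ) (hF : ∀ t, F t = (μ (Set.Iic t)).toReal)
    (hφ2 : Integrable (fun t => (φ t) ^ 2) μ) :
    BddAbove ((fun t => (F t) ^ 2 * (φ t) ^ 2) '' Set.Iic 0) ∧
    BddAbove ((fun t => (1 - F t) ^ 2 * (φ t) ^ 2) '' Set.Ioi 0) ∧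
    (∀ t ≤ (0:ℝ), ∀ x : ℝ,
      ((if t ≤ x then (1:ℝ) else 0) - F x) ^ 2 * (φ x) ^ 2 ≤
        max (sSup ((fun t => (F t) ^ 2 * (φ t) ^ 2) '' Set.Iic 0))
          (max ((1 - F t) ^ 2 * (φ t) ^ 2)
            (sSup ((fun t => (1 - F t) ^ 2 * (φ t) ^ 2) '' Set.Ioi 0)))) ∧
    (∀ t : ℝ, 0 < t → ∀ x : ℝ,
      ((if t ≤ x then (1:ℝ) else 0) - F x) ^ 2 * (φ x) ^ 2 ≤
        max (sSup ((fun t => (F t) ^ 2 * (φ t) ^ 2) '' Set.Iic 0))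
          (max ((F t) ^ 2 * (φ t) ^ 2)
            (sSup ((fun t => (1 - F t) ^ 2 * (φ t) ^ 2) '' Set.Ioi 0)))) ∧
    Measurable (fun t =>
      sSup (Set.range fun x => ((if t ≤ x then (1:ℝ) else 0) - F x) * φ x)) ∧
    Integrable (fun t =>
      (sSup (Set.range fun x => ((if t ≤ x then (1:ℝ) else 0) - F x) * φ x)) ^ 2) μ := by
  obtain ⟨-, hone, hanti, hmono⟩ := hφ
  have hpos (x : ℝ) : 0 ≤ φ x := zero_le_one.trans (hone x)
  have hF' (t : ℝ) : F t = μ.real (Set.Iic t) := hF t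
  have hFc (t : ℝ) : 1 - F t = μ.real (Set.Ioi t) := by
    rw [hF', ← Set.compl_Iic, probReal_compl_eq_one_sub measurableSet_Iic]
  have hF0 (t : ℝ) : 0 ≤ F t := hF' t ▸ measureReal_nonneg
  have hF1 (t : ℝ) : F t ≤ 1 := hF' t ▸ measureReal_le_one
  have hFm : Monotone F := fun s t hst => by
    rw [hF', hF']
    exact measureReal_mono (Set.Iic_subset_Iic.2 hst)
  have b1 : BddAbove ((fun t => (F t) ^ 2 * (φ t) ^ 2) '' Set.Iic 0) := by
    refine ⟨∫ x, (φ x) ^ 2 ∂μ, ?_⟩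
    rintro _ ⟨t, ht, rfl⟩
    calc (F t) ^ 2 * (φ t) ^ 2 ≤ F t * (φ t) ^ 2 := by
          gcongr
          nlinarith [hF0 t, hF1 t]
      _ ≤ _ := hF' t ▸ measureReal_mul_sq_le_integral hφ2 measurableSet_Iic (hpos t)
          fun x hx => hanti (Set.mem_Iic.2 (le_trans hx ht)) ht hx
  have b2 : BddAbove ((fun t => (1 - F t) ^ 2 * (φ t) ^ 2) '' Set.Ioi 0) := by
    refine ⟨∫ x, (φ x) ^ 2 ∂μ, ?_⟩
    rintro _ ⟨t, ht, rfl⟩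
    calc (1 - F t) ^ 2 * (φ t) ^ 2 ≤ (1 - F t) * (φ t) ^ 2 := by
          gcongr
          nlinarith [hF0 t, hF1 t]
      _ ≤ _ := hFc t ▸ measureReal_mul_sq_le_integral hφ2 measurableSet_Ioi (hpos t)
          fun x hx => hmono (Set.mem_Ici.2 (le_of_lt ht))
            (Set.mem_Ici.2 (le_of_lt (lt_trans ht hx))) (le_of_lt hx)
  set M₁ := sSup ((fun t => (F t) ^ 2 * (φ t) ^ 2) '' Set.Iic 0)
  set M₂ := sSup ((fun t => (1 - F t) ^ 2 * (φ t) ^ 2) '' Set.Ioi 0)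
  have le1 (x : ℝ) (hx : x ≤ 0) : (F x) ^ 2 * (φ x) ^ 2 ≤ M₁ := le_csSup b1 ⟨x, hx, rfl⟩
  have le2 (x : ℝ) (hx : 0 < x) : (1 - F x) ^ 2 * (φ x) ^ 2 ≤ M₂ := le_csSup b2 ⟨x, hx, rfl⟩
  have hM₁ : 0 ≤ M₁ := le_trans (by positivity) (le1 0 le_rfl)
  have hM₂ : 0 ≤ M₂ := le_trans (by positivity) (le2 1 one_pos)
  have h3 : ∀ t ≤ (0:ℝ), ∀ x : ℝ, ((if t ≤ x then (1:ℝ) else 0) - F x) ^ 2 * (φ x) ^ 2 ≤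
      max M₁ (max ((1 - F t) ^ 2 * (φ t) ^ 2) M₂) := by
    intro t ht x
    rcases lt_or_ge x t with hxt | hxt
    · rw [if_neg hxt.not_ge, zero_sub, neg_sq]
      exact le_max_of_le_left (le1 x (hxt.le.trans ht))
    · rw [if_pos hxt]
      refine le_max_of_le_right ?_
      rcases le_or_gt x 0 with hx | hx
      · refine le_max_of_le_left ?_
        gcongr
        · exact sub_nonneg.2 (hF1 x)
        · exact hFm hxt
        · exact hpos x
        · exact hanti ht hx hxt
      · exact le_max_of_le_right (le2 x hx)
  have h4 : ∀ t : ℝ, 0 < t → ∀ x : ℝ, ((if t ≤ x then (1:ℝ) else 0) - F x) ^ 2 * (φ x) ^ 2 ≤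
      max M₁ (max ((F t) ^ 2 * (φ t) ^ 2) M₂) := by
    intro t ht x
    rcases lt_or_ge x t with hxt | hxt
    · rw [if_neg hxt.not_ge, zero_sub, neg_sq]
      rcases le_or_gt x 0 with hx | hx
      · exact le_max_of_le_left (le1 x hx)
      · refine le_max_of_le_right (le_max_of_le_left ?_)
        gcongr
        · exact hF0 x
        · exact hFm hxt.le
        · exact hpos x
        · exact hmono hx.le ht.le hxt.le
    · rw [if_pos hxt]
      exact le_max_of_le_right (le_max_of_le_right (le2 x (ht.trans_le hxt)))
  have hbound (t x : ℝ) : (((if t ≤ x then (1:ℝ) else 0) - F x) * φ x) ^ 2 ≤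
      M₁ + M₂ + (φ t) ^ 2 := by
    have hsq : 0 ≤ (φ t) ^ 2 := sq_nonneg _
    rw [mul_pow]
    rcases le_or_gt t 0 with ht | ht
    · refine (h3 t ht x).trans (max_le (by linarith) (max_le ?_ (by linarith)))
      nlinarith [hF0 t, hF1 t, mul_le_of_le_one_left hsq
        (pow_le_one₀ (n := 2) (sub_nonneg.2 (hF1 t)) (sub_le_self 1 (hF0 t)))]
    · refine (h4 t ht x).trans (max_le (by linarith) (max_le ?_ (by linarith)))
      linarith [mul_le_of_le_one_left hsq (pow_le_one₀ (n := 2) (hF0 t) (hF1 t))]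
  have habs (t x : ℝ) : |((if t ≤ x then (1:ℝ) else 0) - F x) * φ x| ≤
      √(M₁ + M₂ + (φ t) ^ 2) := Real.abs_le_sqrt (hbound t x)
  have hmeas : Measurable (fun t =>
      sSup (Set.range fun x => ((if t ≤ x then (1:ℝ) else 0) - F x) * φ x)) := by
    convert measurable_sSup_range_ite (a := fun x => (1 - F x) * φ x)
      (b := fun x => (0 - F x) * φ x) ?_ ?_ using 5 with t x
    · split_ifs <;> rfl
    · refine fun t => ⟨√(M₁ + M₂ + (φ t) ^ 2), ?_⟩
      rintro _ ⟨x, hx, rfl⟩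
      have h := (le_abs_self _).trans (habs t x)
      rwa [if_pos (Set.mem_Ici.1 hx)] at h
    · refine ⟨0, ?_⟩
      rintro _ ⟨x, rfl⟩
      exact mul_nonpos_of_nonpos_of_nonneg (by linarith [hF0 x]) (hpos x)
  refine ⟨b1, b2, h3, h4, hmeas, ?_⟩
  refine ((integrable_const (M₁ + M₂)).add hφ2).mono' (hmeas.pow_const 2).aestronglyMeasurable
    (Eventually.of_forall fun t => ?_)
  have hnn : 0 ≤ M₁ + M₂ + (φ t) ^ 2 := by positivity
  have hub : ∀ y ∈ Set.range fun x => ((if t ≤ x then (1:ℝ) else 0) - F x) * φ x,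
      y ≤ √(M₁ + M₂ + (φ t) ^ 2) := by
    rintro _ ⟨x, rfl⟩
    exact (le_abs_self _).trans (habs t x)
  rw [Real.norm_of_nonneg (sq_nonneg _)]
  refine (Real.sq_le hnn).2 ⟨?_, csSup_le (Set.range_nonempty _) hub⟩
  exact (abs_le.1 (habs t 0)).1.trans (le_csSup ⟨_, hub⟩ ⟨0, rfl⟩)
end

section
/- Proposition C.2: Let (E,d) be a metric space with open-ball σ-algebra ℬ°, and let X_n, n ≥ 0, be (E,ℬ°)-valued random variables on a common probability space (Ω,ℱ,ℙ). Assume ℙ[X₀ ∈ E₀] = 1 for some separable set E₀ ∈ ℬ°, that each map ω ↦ d(X_n(ω),X₀(ω)) is (ℱ,Borel(ℝ₊))-measurable, and that lim_{n→∞} ℙ[d(X_n,X₀) ≥ ε] = 0 for every ε > 0. Then X_n converges in distribution° to X₀, i.e. E[f(X_n)] → E[f(X₀)] for every bounded, continuous, (ℬ°,Borel(ℝ))-measurable f : E → ℝ. -/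
open MeasureTheory Filter Topology

/-- **Proposition C.2**: convergence in probability° implies convergence in
distribution°, provided the limit takes values a.s. in a separable set `E₀ ∈ ℬ°`. -/
theorem convergence_in_prob_implies_convergence_in_dist
    {E : Type*} [MetricSpace E] [mE : MeasurableSpace E] (hmE : mE = ballSigma E)
    {Ω : Type*} [MeasurableSpace Ω] (P : Measure Ω) [IsProbabilityMeasure P]
    (X : ℕ → Ω → E) (X₀ : Ω → E)
    (hXmeas : ∀ n, Measurable (X n)) (hX₀meas : Measurable X₀)
    (E₀ : Set E) (hE₀sep : TopologicalSpace.IsSeparable E₀) (hE₀meas : MeasurableSet E₀)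
    (hE₀full : P {ω | X₀ ω ∈ E₀} = 1)
    (hdist : ∀ n, Measurable fun ω => dist (X n ω) (X₀ ω))
    (hprob : ∀ ε : ℝ, 0 < ε →
      Tendsto (fun n => P {ω | ε ≤ dist (X n ω) (X₀ ω)}) atTop (𝓝 0)) :
    ∀ f : E → ℝ, Continuous f → (∃ C, ∀ x, |f x| ≤ C) → Measurable f →
      Tendsto (fun n => ∫ ω, f (X n ω) ∂P) atTop (𝓝 (∫ ω, f (X₀ ω) ∂P)) := by
  rintro f hf ⟨C, hC⟩ hfmeas
  have hX : TendstoInMeasure P X atTop X₀ := tendstoInMeasure_iff_dist.2 hprob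
  refine tendsto_of_subseq_tendsto fun ns hns => ?_
  obtain ⟨ms, -, hms⟩ := (hX.comp hns).exists_seq_tendsto_ae
  refine ⟨ms, tendsto_integral_of_dominated_convergence (fun _ => C)
    (fun n => (hfmeas.comp (hXmeas _)).aestronglyMeasurable) (integrable_const C)
    (fun n => ae_of_all _ fun ω => hC _) ?_⟩
  filter_upwards [hms] with ω hω
  exact (hf.tendsto _).comp hω
end
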